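/- Let F = (X_n, K_n, π_n)_{n≥1} be a family of irreducible birth and death chains on X_n = {0,1,...,n}. Let λ_n be the smallest non-zero eigenvalue of I − K_n. For each n choose M_n ∈ X_n with inf_n π_n([0,M_n]) > 0 and inf_n π_n([M_n,n]) > 0, and set s_n = E_0 τ^{(n)}_{M_n} + E_n τ^{(n)}_{M_n} and c_n² = Var_0 τ^{(n)}_{M_n} + Var_n τ^{(n)}_{M_n}, where τ^{(n)}_i is the discrete-time hitting time. Assume K_n(i,i+1) + K_n(i+1,i) ≤ 1 for all i and n. Then F^L has a separation cutoff if and only if s_n λ_n → ∞, if and only if s_n/c_n → ∞; furthermore, if s_n/c_n → ∞, then F^L has a (s_n, max{c_n, 1/λ_n}) separation cutoff. -/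

import Mathlib

open scoped BigOperators
open Filter Matrix Polynomial MeasureTheory

noncomputable section

/-- An irreducible birth and death chain on `{0,1,...,n}`, together with its
(unique) stationary distribution. -/
structure BDChain (n : ℕ) where
  K : Matrix (Fin (n + 1)) (Fin (n + 1)) ℝ
  pi : Fin (n + 1) → ℝ
  K_nonneg : ∀ i j, 0 ≤ K i j
  K_rowSum : ∀ i, ∑ j, K i j = 1
  K_tridiag : ∀ i j : Fin (n + 1), 1 < |(i : ℤ) - (j : ℤ)| → K i j = 0
  K_irred : ∀ i : ℕ, ∀ h : i < n,
    0 < K ⟨i, by omega⟩ ⟨i + 1, by omega⟩ ∧ 0 < K ⟨i + 1, by omega⟩ ⟨i, by omega⟩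
  pi_pos : ∀ i, 0 < pi i
  pi_sum : ∑ i, pi i = 1
  pi_stat : ∀ j, ∑ i, pi i * K i j = pi j

namespace BDChain

variable {n : ℕ}

/-- `π([0,M])` -/
def piLow (c : BDChain n) (M : Fin (n + 1)) : ℝ :=
  ∑ ℓ : Fin (n + 1), if ℓ ≤ M then c.pi ℓ else 0

/-- `π([M,n])` -/
def piHigh (c : BDChain n) (M : Fin (n + 1)) : ℝ :=
  ∑ ℓ : Fin (n + 1), if M ≤ ℓ then c.pi ℓ else 0

/-- `π([a,b])` -/
def piInt (c : BDChain n) (a b : Fin (n + 1)) : ℝ :=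
  ∑ ℓ : Fin (n + 1), if a ≤ ℓ ∧ ℓ ≤ b then c.pi ℓ else 0

/-- The substochastic matrix of the chain killed at state `i`. -/
def killed (c : BDChain n) (i : Fin (n + 1)) : Matrix (Fin (n + 1)) (Fin (n + 1)) ℝ :=
  Matrix.of fun x y => if x = i ∨ y = i then 0 else c.K x y

/-- `P_j(τ_i > m)`, where `τ_i` is the discrete-time hitting time of state `i`. -/
def hitSurv (c : BDChain n) (i j : Fin (n + 1)) (m : ℕ) : ℝ :=
  if j = i then 0 else ∑ y, (c.killed i ^ m) j y

/-- `P_j(τ̃_i > t)`, where `τ̃_i` is the continuous-time hitting time of state `i`. -/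
def hitSurvC (c : BDChain n) (i j : Fin (n + 1)) (t : ℝ) : ℝ :=
  ∑' m : ℕ, (Real.exp (-t) * t ^ m / m.factorial) * c.hitSurv i j m

/-- `E_j τ_i` -/
def hitMean (c : BDChain n) (i j : Fin (n + 1)) : ℝ :=
  ∑' m : ℕ, c.hitSurv i j m

/-- `Var_j τ_i` -/
def hitVar (c : BDChain n) (i j : Fin (n + 1)) : ℝ :=
  (∑' m : ℕ, (2 * (m : ℝ) + 1) * c.hitSurv i j m) - (c.hitMean i j) ^ 2

/-- `E_j τ̃_i` -/
def hitMeanC (c : BDChain n) (i j : Fin (n + 1)) : ℝ :=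
  ∫ t in Set.Ioi (0 : ℝ), c.hitSurvC i j t

/-- `Var_j τ̃_i` -/
def hitVarC (c : BDChain n) (i j : Fin (n + 1)) : ℝ :=
  (∫ t in Set.Ioi (0 : ℝ), 2 * t * c.hitSurvC i j t) - (c.hitMeanC i j) ^ 2

/-- The substochastic matrix of the chain killed at states `i` and `k`. -/
def killed2 (c : BDChain n) (i k : Fin (n + 1)) : Matrix (Fin (n + 1)) (Fin (n + 1)) ℝ :=
  Matrix.of fun x y => if x = i ∨ x = k ∨ y = i ∨ y = k then 0 else c.K x y

/-- `P_j(min{τ_i, τ_k} > m)` -/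
def hitSurv2 (c : BDChain n) (i k j : Fin (n + 1)) (m : ℕ) : ℝ :=
  if j = i ∨ j = k then 0 else ∑ y, (c.killed2 i k ^ m) j y

/-- `E_j min{τ_i, τ_k}` -/
def hitMean2 (c : BDChain n) (i k j : Fin (n + 1)) : ℝ :=
  ∑' m : ℕ, c.hitSurv2 i k j m

/-- `E_j min{τ̃_i, τ̃_k}` -/
def hitMean2C (c : BDChain n) (i k j : Fin (n + 1)) : ℝ :=
  ∫ t in Set.Ioi (0 : ℝ),
    ∑' m : ℕ, (Real.exp (-t) * t ^ m / m.factorial) * c.hitSurv2 i k j m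

/-- The continuous-time kernel `H_t(x,y) = e^{-t(I-K)}(x,y)`. -/
def Ht (c : BDChain n) (t : ℝ) (x y : Fin (n + 1)) : ℝ :=
  ∑' m : ℕ, (Real.exp (-t) * t ^ m / m.factorial) * (c.K ^ m) x y

/-- Discrete-time total variation distance from starting state `x` at time `m`. -/
def dTV (c : BDChain n) (x : Fin (n + 1)) (m : ℕ) : ℝ :=
  ⨆ A : Finset (Fin (n + 1)), (∑ y ∈ A, (c.K ^ m) x y - ∑ y ∈ A, c.pi y)

/-- Continuous-time total variation distance from starting state `x` at time `t`. -/
def dTVC (c : BDChain n) (x : Fin (n + 1)) (t : ℝ) : ℝ :=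
  ⨆ A : Finset (Fin (n + 1)), (∑ y ∈ A, c.Ht t x y - ∑ y ∈ A, c.pi y)

/-- Maximum (over starting states) discrete-time total variation distance. -/
def dTVMax (c : BDChain n) (m : ℕ) : ℝ := ⨆ x, c.dTV x m

/-- Maximum (over starting states) continuous-time total variation distance. -/
def dTVMaxC (c : BDChain n) (t : ℝ) : ℝ := ⨆ x, c.dTVC x t

/-- Discrete-time separation from starting state `x` at time `m`. -/
def sep (c : BDChain n) (x : Fin (n + 1)) (m : ℕ) : ℝ :=
  ⨆ y, (1 - (c.K ^ m) x y / c.pi y)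

/-- Continuous-time separation from starting state `x` at time `t`. -/
def sepC (c : BDChain n) (x : Fin (n + 1)) (t : ℝ) : ℝ :=
  ⨆ y, (1 - c.Ht t x y / c.pi y)

end BDChain

/-- Discrete-time `ε`-mixing time for a distance profile `d`. -/
def mixD (d : ℕ → ℝ) (ε : ℝ) : ℕ := sInf {m : ℕ | d m ≤ ε}

/-- Continuous-time `ε`-mixing time for a distance profile `d`. -/
def mixC (d : ℝ → ℝ) (ε : ℝ) : ℝ := sInf {t : ℝ | 0 ≤ t ∧ d t ≤ ε}

/-- The set of (real) eigenvalues of a square matrix. -/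
def eigSet {ι : Type*} [Fintype ι] (M : Matrix ι ι ℝ) : Set ℝ :=
  {x | ∃ v : ι → ℝ, v ≠ 0 ∧ M.mulVec v = x • v}

/-- `l` is the smallest non-zero eigenvalue of `M`. -/
def IsSmallestNonzeroEig {ι : Type*} [Fintype ι] (M : Matrix ι ι ℝ) (l : ℝ) : Prop :=
  l ∈ eigSet M ∧ l ≠ 0 ∧ ∀ x ∈ eigSet M, x ≠ 0 → l ≤ x

/-- `l` is the smallest eigenvalue of `M`. -/
def IsSmallestEig {ι : Type*} [Fintype ι] (M : Matrix ι ι ℝ) (l : ℝ) : Prop :=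
  l ∈ eigSet M ∧ ∀ x ∈ eigSet M, l ≤ x

/-- The principal submatrix of `I - K` indexed by the states `0, 1, ..., M-1`. -/
def BDChain.subIK {n : ℕ} (c : BDChain n) (M : Fin (n + 1)) :
    Matrix (Fin (M : ℕ)) (Fin (M : ℕ)) ℝ :=
  Matrix.of fun a b =>
    (1 - c.K) (Fin.castLE M.isLt.le a) (Fin.castLE M.isLt.le b)

/-- A family of chains, with `ε ↦ n ↦ T ε n` the mixing time profile, presents a cutoff
with cutoff time `t`. -/
def cutoffWith (T : ℝ → ℕ → ℝ) (t : ℕ → ℝ) : Prop :=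
  ∀ ε ∈ Set.Ioo (0 : ℝ) 1, Filter.Tendsto (fun n => T ε n / t n) Filter.atTop (nhds 1)

/-- A family of chains presents a cutoff. -/
def hasCutoff (T : ℝ → ℕ → ℝ) : Prop :=
  ∃ t : ℕ → ℝ, (∀ n, 0 < t n) ∧ cutoffWith T t

/-- A family of chains presents a `(t_n, b_n)` cutoff. -/
def cutoffWindow (T : ℝ → ℕ → ℝ) (t b : ℕ → ℝ) : Prop :=
  (∀ᶠ n in Filter.atTop, 0 < t n) ∧ (∀ᶠ n in Filter.atTop, 0 < b n) ∧
  Filter.Tendsto (fun n => b n / t n) Filter.atTop (nhds 0) ∧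
  ∀ ε ∈ Set.Ioo (0 : ℝ) 1, ∃ C : ℝ, ∀ᶠ n in Filter.atTop, |T ε n - t n| ≤ C * b n


section

open Topology Set

/-- Monotone convergence along a filter, for nonnegative series dominated by their limit terms:
boundedness of the sums gives summability of the limit terms and convergence of the sums. -/
lemma summable_and_tendsto_tsum_of_le {α : Type*} {l : Filter α} [l.NeBot] {c : ℕ → α → ℝ}
    {c' : ℕ → ℝ} {U : α → ℝ} {u : ℝ}
    (hlim : ∀ m, Tendsto (c m) l (𝓝 (c' m)))
    (hle : ∀ᶠ x in l, ∀ m, 0 ≤ c m x ∧ c m x ≤ c' m)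
    (hsum : ∀ᶠ x in l, Summable fun m => c m x)
    (hU : ∀ᶠ x in l, ∑' m, c m x ≤ U x) (hu : Tendsto U l (𝓝 u)) :
    Summable c' ∧ Tendsto (fun x => ∑' m, c m x) l (𝓝 (∑' m, c' m)) := by
  have h0 : ∀ m, 0 ≤ c' m := fun m => by
    obtain ⟨x, hx⟩ := hle.exists
    exact (hx m).1.trans (hx m).2
  have hs : Summable c' := by
    refine summable_of_sum_range_le (c := u) h0 fun N => ?_
    refine le_of_tendsto_of_tendsto (tendsto_finsetSum _ fun m _ => hlim m) hu ?_
    filter_upwards [hle, hsum, hU] with x h1 h2 h3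
    exact (h2.sum_le_tsum _ fun m _ => (h1 m).1).trans h3
  refine ⟨hs, tendsto_tsum_of_dominated_convergence hs hlim ?_⟩
  filter_upwards [hle] with x h m
  rw [Real.norm_of_nonneg (h m).1]
  exact (h m).2

/-- The function `R` with `(1 - x) R(x) = 1 - F(x)`, where `F` is the generating function of a
formal sum of independent geometric variables with parameters `μ i`. -/
lemma exists_geometric_moment_function {ι : Type*} (μ : ι → ℝ) (hμ : ∀ i, 0 < μ i)
    (S : Finset ι) :
    ∃ (R : ℝ → ℝ) (d : ℝ), HasDerivAt R d 1 ∧ R 1 = ∑ i ∈ S, 1 / μ i ∧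
      2 * d + R 1 - R 1 ^ 2 = ∑ i ∈ S, (1 - μ i) / μ i ^ 2 ∧
      ∀ x ∈ Ioo (0 : ℝ) 1, (1 - x) * R x = 1 - ∏ i ∈ S, (μ i * x / (1 - (1 - μ i) * x)) := by
  classical
  induction S using Finset.induction_on with
  | empty => exact ⟨fun _ => 0, 0, hasDerivAt_const (1 : ℝ) (0 : ℝ), by simp, by simp, by simp⟩
  | insert i S hi ih =>
    obtain ⟨R, d, hd, h1, h2, h3⟩ := ih
    have hi0 := hμ i
    set R' : ℝ → ℝ := fun x => (1 - (1 - μ i) * x)⁻¹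
    have hR'1 : R' 1 = 1 / μ i := by simp [R']
    have hd' : HasDerivAt R' ((1 - μ i) / μ i ^ 2) 1 := by
      have : HasDerivAt (fun x : ℝ => 1 - (1 - μ i) * x) (-(1 - μ i)) 1 := by
        simpa using ((hasDerivAt_id (1 : ℝ)).const_mul (1 - μ i)).const_sub 1
      convert! this.inv (by simpa using hi0.ne') using 1
      simp
    have hlin : HasDerivAt (fun x : ℝ => 1 - x) (-1) 1 := by
      simpa using (hasDerivAt_id (1 : ℝ)).const_sub 1
    refine ⟨fun x => R x + R' x - (1 - x) * (R x * R' x), _,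
      (hd.add hd').sub (hlin.mul (hd.mul hd')), ?_, ?_, ?_⟩
    · rw [Finset.sum_insert hi, ← h1, ← hR'1]; ring
    · rw [Finset.sum_insert hi, ← h2]
      simp only [hR'1, sub_self, zero_mul]
      field_simp
      ring
    · intro x hx
      rw [Finset.prod_insert hi]
      have hden : 0 < 1 - (1 - μ i) * x := by nlinarith [hx.2, mul_pos hi0 hx.1]
      have e : μ i * x / (1 - (1 - μ i) * x) = 1 - (1 - x) * R' x := by
        simp only [R']
        rw [← div_eq_mul_inv, eq_sub_iff_add_eq, ← add_div, div_eq_one_iff_eq hden.ne']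
        ring
      have e2 : ∏ i ∈ S, (μ i * x / (1 - (1 - μ i) * x)) = 1 - (1 - x) * R x := by
        rw [h3 x hx]; ring
      rw [e, e2]; ring

lemma summable_mul_pow_of_mem_unit {a : ℕ → ℝ} (ha : ∀ m, 0 ≤ a m) (ha1 : ∀ m, a m ≤ 1) {x : ℝ}
    (hx : x ∈ Ioo (0 : ℝ) 1) : Summable fun m => a m * x ^ m :=
  Summable.of_nonneg_of_le (fun m => mul_nonneg (ha m) (pow_nonneg hx.1.le m))
    (fun m => mul_le_of_le_one_left (pow_nonneg hx.1.le m) (ha1 m))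
    (summable_geometric_of_lt_one hx.1.le hx.2)

lemma one_sub_mul_tsum_le_one {a : ℕ → ℝ} (ha : ∀ m, 0 ≤ a m) (ha1 : ∀ m, a m ≤ 1) {x : ℝ}
    (hx : x ∈ Ioo (0 : ℝ) 1) : (1 - x) * ∑' m, a m * x ^ m ≤ 1 := by
  have h : ∑' m, a m * x ^ m ≤ ∑' m, x ^ m :=
    (summable_mul_pow_of_mem_unit ha ha1 hx).tsum_le_tsum
      (fun m => mul_le_of_le_one_left (pow_nonneg hx.1.le m) (ha1 m))
      (summable_geometric_of_lt_one hx.1.le hx.2)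
  rw [tsum_geometric_of_lt_one hx.1.le hx.2] at h
  have h1 : 0 < 1 - x := sub_pos.2 hx.2
  calc (1 - x) * ∑' m, a m * x ^ m ≤ (1 - x) * (1 - x)⁻¹ := by gcongr
    _ = 1 := mul_inv_cancel₀ h1.ne'

lemma Ioo_mem_nhdsLT_one : ∀ᶠ x in 𝓝[<] (1 : ℝ), x ∈ Ioo (0 : ℝ) 1 :=
  Ioo_mem_nhdsLT one_pos

/-- Mean and variance of two independent times with survival functions `a`, `b`, when the product
of their generating functions is that of a formal sum of geometric variables. -/
lemma moments_of_generating_function {ι : Type*} [Fintype ι] (μ : ι → ℝ) (hμ : ∀ i, 0 < μ i)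
    (a b : ℕ → ℝ) (ha : ∀ m, 0 ≤ a m) (ha1 : ∀ m, a m ≤ 1)
    (hb : ∀ m, 0 ≤ b m) (hb1 : ∀ m, b m ≤ 1)
    (h : ∀ x ∈ Ioo (0 : ℝ) 1, (1 - (1 - x) * ∑' m, a m * x ^ m) *
      (1 - (1 - x) * ∑' m, b m * x ^ m) = ∏ i, (μ i * x / (1 - (1 - μ i) * x))) :
    Summable a ∧ Summable (fun m : ℕ => (m : ℝ) * a m) ∧
    ∑' m, a m + ∑' m, b m = ∑ i, 1 / μ i ∧
    (∑' m : ℕ, (2 * (m : ℝ) + 1) * a m - (∑' m, a m) ^ 2) +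
      (∑' m : ℕ, (2 * (m : ℝ) + 1) * b m - (∑' m, b m) ^ 2) = ∑ i, (1 - μ i) / μ i ^ 2 := by
  obtain ⟨R, d, hd, hR1, hR2, hR⟩ := exists_geometric_moment_function μ hμ Finset.univ
  set A : ℝ → ℝ := fun x => ∑' m, a m * x ^ m
  set B : ℝ → ℝ := fun x => ∑' m, b m * x ^ m
  have hA0 : ∀ x ∈ Ioo (0 : ℝ) 1, 0 ≤ A x := fun x hx =>
    tsum_nonneg fun m => mul_nonneg (ha m) (pow_nonneg hx.1.le m)
  have hB0 : ∀ x ∈ Ioo (0 : ℝ) 1, 0 ≤ B x := fun x hx =>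
    tsum_nonneg fun m => mul_nonneg (hb m) (pow_nonneg hx.1.le m)
  have hA1 : ∀ x ∈ Ioo (0 : ℝ) 1, (1 - x) * A x ≤ 1 := fun x hx => one_sub_mul_tsum_le_one ha ha1 hx
  have hB1 : ∀ x ∈ Ioo (0 : ℝ) 1, (1 - x) * B x ≤ 1 := fun x hx => one_sub_mul_tsum_le_one hb hb1 hx
  have hAB : ∀ x ∈ Ioo (0 : ℝ) 1, R x = A x + B x - (1 - x) * (A x * B x) := by
    intro x hx
    have h1 : (1 - x) ≠ 0 := (sub_pos.2 hx.2).ne'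
    have := hR x hx
    rw [← h x hx] at this
    apply mul_left_cancel₀ h1
    rw [this]; ring
  have hRt : Tendsto R (𝓝[<] 1) (𝓝 (R 1)) := hd.continuousAt.tendsto.mono_left nhdsWithin_le_nhds
  have key : ∀ c : ℕ → ℝ, (∀ m, 0 ≤ c m) → (∀ m, c m ≤ 1) →
      (∀ x ∈ Ioo (0 : ℝ) 1, ∑' m, c m * x ^ m ≤ R x) →
      Summable c ∧ Tendsto (fun x => ∑' m, c m * x ^ m) (𝓝[<] 1) (𝓝 (∑' m, c m)) := by
    intro c hc hc1 hcR
    refine summable_and_tendsto_tsum_of_le (c := fun m x => c m * x ^ m) (U := R) (u := R 1)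
      (fun m => ?_) ?_ ?_ ?_ hRt
    · have : ContinuousAt (fun x : ℝ => c m * x ^ m) 1 := by fun_prop
      simpa using this.tendsto.mono_left nhdsWithin_le_nhds
    · filter_upwards [Ioo_mem_nhdsLT_one] with x hx m
      exact ⟨mul_nonneg (hc m) (pow_nonneg hx.1.le m),
        mul_le_of_le_one_right (hc m) (pow_le_one₀ hx.1.le hx.2.le)⟩
    · filter_upwards [Ioo_mem_nhdsLT_one] with x hx
      exact summable_mul_pow_of_mem_unit hc hc1 hx
    · filter_upwards [Ioo_mem_nhdsLT_one] with x hx using hcR x hx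
  obtain ⟨hsa, hta⟩ := key a ha ha1 fun x hx => by
    change A x ≤ R x
    rw [hAB x hx]; nlinarith [hA1 x hx, hB0 x hx]
  obtain ⟨hsb, htb⟩ := key b hb hb1 fun x hx => by
    change B x ≤ R x
    rw [hAB x hx]; nlinarith [hB1 x hx, hA0 x hx]
  have hlin : Tendsto (fun x : ℝ => 1 - x) (𝓝[<] 1) (𝓝 0) := by
    have : ContinuousAt (fun x : ℝ => 1 - x) 1 := by fun_prop
    simpa using this.tendsto.mono_left nhdsWithin_le_nhds
  have hsumR : ∑' m, a m + ∑' m, b m = R 1 := by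
    refine tendsto_nhds_unique ?_ hRt
    have := (hta.add htb).sub (hlin.mul (hta.mul htb))
    rw [zero_mul, sub_zero] at this
    refine this.congr' ?_
    filter_upwards [Ioo_mem_nhdsLT_one] with x hx using (hAB x hx).symm
  have hslope : Tendsto (fun x => (R 1 - R x) / (1 - x)) (𝓝[<] 1) (𝓝 d) := by
    have := (hasDerivAt_iff_tendsto_slope.1 hd).mono_left
      (nhdsWithin_mono 1 fun x (hx : x < 1) => hx.ne)
    refine this.congr fun x => ?_
    rw [slope_def_field, ← neg_sub (R 1), ← neg_sub 1 x, neg_div_neg_eq]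
  have diff : ∀ c : ℕ → ℝ, (∀ m, 0 ≤ c m) → (∀ m, c m ≤ 1) → Summable c → ∀ x ∈ Ioo (0 : ℝ) 1,
      Summable (fun m => c m * ∑ k ∈ Finset.range m, x ^ k) ∧
      (∑' m, c m - ∑' m, c m * x ^ m) / (1 - x) = ∑' m, c m * ∑ k ∈ Finset.range m, x ^ k := by
    intro c hc hc1 hcs x hx
    have h1 : (1 - x) ≠ 0 := (sub_pos.2 hx.2).ne'
    have hs := (hcs.sub (summable_mul_pow_of_mem_unit hc hc1 hx)).div_const (1 - x)
    have e : ∀ m, (c m - c m * x ^ m) / (1 - x) = c m * ∑ k ∈ Finset.range m, x ^ k := by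
      intro m
      rw [div_eq_iff h1]
      linear_combination -c m * mul_neg_geom_sum x m
    refine ⟨hs.congr e, ?_⟩
    rw [← hcs.tsum_sub (summable_mul_pow_of_mem_unit hc hc1 hx), ← tsum_div_const]
    exact tsum_congr e
  have hslopeAB : ∀ x ∈ Ioo (0 : ℝ) 1, (∑' m, a m - A x) / (1 - x) + (∑' m, b m - B x) / (1 - x) =
      (R 1 - R x) / (1 - x) - A x * B x := by
    intro x hx
    have h1 : (1 - x) ≠ 0 := (sub_pos.2 hx.2).ne'
    rw [hAB x hx, ← hsumR]
    field_simp
    ring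
  have key2 : ∀ c : ℕ → ℝ, (∀ m, 0 ≤ c m) → (∀ m, c m ≤ 1) → Summable c →
      (∀ x ∈ Ioo (0 : ℝ) 1, (∑' m, c m - ∑' m, c m * x ^ m) / (1 - x) ≤ (R 1 - R x) / (1 - x)) →
      Summable (fun m : ℕ => (m : ℝ) * c m) ∧
      Tendsto (fun x => (∑' m, c m - ∑' m, c m * x ^ m) / (1 - x)) (𝓝[<] 1)
        (𝓝 (∑' m : ℕ, (m : ℝ) * c m)) := by
    intro c hc hc1 hcs hcR
    have := summable_and_tendsto_tsum_of_le (l := 𝓝[<] (1 : ℝ))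
      (c := fun m x => c m * ∑ k ∈ Finset.range m, x ^ k) (c' := fun m : ℕ => (m : ℝ) * c m)
      (U := fun x => (R 1 - R x) / (1 - x)) (u := d) (fun m => ?_) ?_ ?_ ?_ hslope
    · refine ⟨this.1, this.2.congr' ?_⟩
      filter_upwards [Ioo_mem_nhdsLT_one] with x hx using (diff c hc hc1 hcs x hx).2.symm
    · have : ContinuousAt (fun x : ℝ => c m * ∑ k ∈ Finset.range m, x ^ k) 1 := by fun_prop
      simpa [mul_comm] using this.tendsto.mono_left nhdsWithin_le_nhds
    · filter_upwards [Ioo_mem_nhdsLT_one] with x hx m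
      refine ⟨mul_nonneg (hc m) (Finset.sum_nonneg fun k _ => pow_nonneg hx.1.le k), ?_⟩
      rw [mul_comm]
      refine mul_le_mul_of_nonneg_right ?_ (hc m)
      calc ∑ k ∈ Finset.range m, x ^ k ≤ ∑ k ∈ Finset.range m, (1 : ℝ) :=
            Finset.sum_le_sum fun k _ => pow_le_one₀ hx.1.le hx.2.le
        _ = m := by simp
    · filter_upwards [Ioo_mem_nhdsLT_one] with x hx using (diff c hc hc1 hcs x hx).1
    · filter_upwards [Ioo_mem_nhdsLT_one] with x hx
      rw [← (diff c hc hc1 hcs x hx).2]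
      exact hcR x hx
  have hnn : ∀ c : ℕ → ℝ, (∀ m, 0 ≤ c m) → (∀ m, c m ≤ 1) → Summable c → ∀ x ∈ Ioo (0 : ℝ) 1,
      0 ≤ (∑' m, c m - ∑' m, c m * x ^ m) / (1 - x) := by
    intro c hc hc1 hcs x hx
    rw [(diff c hc hc1 hcs x hx).2]
    exact tsum_nonneg fun m => mul_nonneg (hc m) (Finset.sum_nonneg fun k _ => pow_nonneg hx.1.le k)
  obtain ⟨hsa', hta'⟩ := key2 a ha ha1 hsa fun x hx => by
    have := hslopeAB x hx
    have := hnn b hb hb1 hsb x hx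
    have := mul_nonneg (hA0 x hx) (hB0 x hx)
    simp only [A, B] at *
    linarith
  obtain ⟨hsb', htb'⟩ := key2 b hb hb1 hsb fun x hx => by
    have := hslopeAB x hx
    have := hnn a ha ha1 hsa x hx
    have := mul_nonneg (hA0 x hx) (hB0 x hx)
    simp only [A, B] at *
    linarith
  have hder : ∑' m : ℕ, (m : ℝ) * a m + ∑' m : ℕ, (m : ℝ) * b m =
      d - (∑' m, a m) * ∑' m, b m := by
    refine tendsto_nhds_unique (hta'.add htb') ((hslope.sub (hta.mul htb)).congr' ?_)
    filter_upwards [Ioo_mem_nhdsLT_one] with x hx using (hslopeAB x hx).symm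
  have hsq : ∀ c : ℕ → ℝ, Summable c → Summable (fun m : ℕ => (m : ℝ) * c m) →
      ∑' m : ℕ, (2 * (m : ℝ) + 1) * c m = 2 * ∑' m : ℕ, (m : ℝ) * c m + ∑' m, c m := by
    intro c h1 h2
    rw [← tsum_mul_left, ← (h2.mul_left 2).tsum_add h1]
    exact tsum_congr fun m => by ring
  refine ⟨hsa, hsa', hsumR.trans hR1, ?_⟩
  rw [← hR2, hsq a hsa hsa', hsq b hsb hsb', ← hsumR]
  linear_combination 2 * hder

lemma nonneg_add_hasSum_of_antitone {a g : ℕ → ℝ} {S : ℝ} (ha : ∀ m, 0 ≤ a m)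
    (ha1 : a 0 ≤ 1) (hanti : Antitone a) (hg : ∀ j, 0 ≤ g j)
    (hS : HasSum (fun j => (g (j + 1) - g j) * a j) S) : 0 ≤ g 0 + S := by
  have h : ∀ N, g N * a N ≤ g 0 + ∑ j ∈ Finset.range N, (g (j + 1) - g j) * a j := by
    intro N
    induction N with
    | zero => simpa using mul_le_of_le_one_right (hg 0) ha1
    | succ N ih =>
      rw [Finset.sum_range_succ]
      nlinarith [mul_le_mul_of_nonneg_left (hanti N.le_succ) (hg (N + 1))]
  exact ge_of_tendsto' (hS.tendsto_sum_nat.const_add (g 0))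
    fun N => (mul_nonneg (hg N) (ha N)).trans (h N)

/-- Chebyshev's inequality for a time with survival function `a`. -/
lemma chebyshev_of_survival {a : ℕ → ℝ} (ha : ∀ m, 0 ≤ a m) (ha1 : a 0 ≤ 1) (hanti : Antitone a)
    (hs : Summable a) (hs' : Summable fun m : ℕ => (m : ℝ) * a m) {θ v : ℝ}
    (hθ : ∑' m, a m = θ) (hv : ∑' m : ℕ, (2 * (m : ℝ) + 1) * a m - θ ^ 2 = v) (m : ℕ) :
    (θ ≤ m + 1 → (m + 1 - θ) ^ 2 * a m ≤ v) ∧ ((m : ℝ) ≤ θ → (θ - m) ^ 2 * (1 - a m) ≤ v) := by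
  have hE : HasSum (fun j : ℕ => (2 * (j : ℝ) + 1) * a j) (v + θ ^ 2) := by
    rw [← hv, sub_add_cancel]
    refine Summable.hasSum (((hs'.mul_left 2).add hs).congr fun j => by ring)
  have hM : HasSum (fun j => (2 * θ) * a j) (2 * θ * θ) := by
    rw [← hθ]; exact hs.hasSum.mul_left _
  have hsingle : ∀ r : ℝ, HasSum (fun j => if j = m then r * a m else 0) (r * a m) := fun r =>
    hasSum_ite_eq m (r * a m)
  constructor
  · intro h
    have := nonneg_add_hasSum_of_antitone (a := a)
      (g := fun j => ((j : ℝ) - θ) ^ 2 - if m + 1 ≤ j then (m + 1 - θ) ^ 2 else 0)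
      (S := v + θ ^ 2 - 2 * θ * θ - (m + 1 - θ) ^ 2 * a m) ha ha1 hanti ?_ ?_
    · simp at this
      linarith
    · intro j
      split_ifs with hj
      · have : (m : ℝ) + 1 ≤ j := by exact_mod_cast hj
        nlinarith
      · simpa using sq_nonneg _
    · refine ((hE.sub hM).sub (hsingle _)).congr_fun fun j => ?_
      push_cast
      rcases lt_trichotomy j m with hj | rfl | hj
      · rw [if_neg (by omega), if_neg (by omega), if_neg (by omega)]; ring
      · rw [if_pos (by omega), if_neg (by omega), if_pos rfl]; ring
      · rw [if_pos (by omega), if_pos (by omega), if_neg (by omega)]; ring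
  · intro h
    have := nonneg_add_hasSum_of_antitone (a := a)
      (g := fun j => ((j : ℝ) - θ) ^ 2 - if j ≤ m then (θ - m) ^ 2 else 0)
      (S := v + θ ^ 2 - 2 * θ * θ + (θ - m) ^ 2 * a m) ha ha1 hanti ?_ ?_
    · simp at this
      linarith
    · intro j
      split_ifs with hj
      · have : (j : ℝ) ≤ m := by exact_mod_cast hj
        nlinarith
      · simpa using sq_nonneg _
    · refine ((hE.sub hM).add (hsingle _)).congr_fun fun j => ?_
      push_cast
      rcases lt_trichotomy j m with hj | rfl | hj
      · rw [if_pos (by omega), if_pos (by omega), if_neg (by omega)]; ring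
      · rw [if_neg (by omega), if_pos (by omega), if_pos rfl]; ring
      · rw [if_neg (by omega), if_neg (by omega), if_neg (by omega)]; ring

end

/-- Spectral theorem for real symmetric matrices, with eigenvalues in nonincreasing order. -/
lemma exists_sorted_eigenbasis {N : ℕ} (A : Matrix (Fin N) (Fin N) ℝ) (hA : A.IsHermitian) :
    ∃ (α : Fin N → ℝ) (e : Fin N → Fin N → ℝ), Antitone α ∧
      (∀ i j, e i ⬝ᵥ e j = if i = j then 1 else 0) ∧ (∀ k, A *ᵥ e k = α k • e k) ∧
      (∀ w : ℝ, (w • (1 : Matrix (Fin N) (Fin N) ℝ) + A).det = ∏ k, (w + α k)) ∧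
      A.trace = ∑ k, α k := by
  let σ : Fin N ≃ Fin N := (finCongr (Fintype.card_fin N).symm).trans
    (Fintype.equivOfCardEq (Fintype.card_fin _))
  have hα : ∀ k, hA.eigenvalues (σ k) = hA.eigenvalues₀ (finCongr (Fintype.card_fin N).symm k) := by
    intro k
    simp [Matrix.IsHermitian.eigenvalues, σ]
  refine ⟨fun k => hA.eigenvalues (σ k), fun k => WithLp.ofLp (hA.eigenvectorBasis (σ k)), ?_, ?_, ?_, ?_, ?_⟩
  · intro i j hij
    simp only [hα]
    apply hA.eigenvalues₀_antitone
    simpa using hij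
  · intro i j
    have := orthonormal_iff_ite.1 hA.eigenvectorBasis.orthonormal (σ j) (σ i)
    simp only [EmbeddingLike.apply_eq_iff_eq] at this
    rw [EuclideanSpace.inner_eq_star_dotProduct] at this
    simpa [eq_comm] using this
  · intro k
    exact hA.mulVec_eigenvectorBasis (σ k)
  · intro w
    have h := congrArg (Polynomial.eval (-w)) hA.charpoly_eq
    rw [Matrix.eval_charpoly, Polynomial.eval_prod] at h
    have e1 : (w • (1 : Matrix (Fin N) (Fin N) ℝ) + A) =
        -(Matrix.scalar (Fin N) (-w) - A) := by
      rw [neg_sub, sub_eq_add_neg, add_comm, ← map_neg, neg_neg]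
      simp [Matrix.smul_one_eq_diagonal]
    rw [e1, Matrix.det_neg, h, Equiv.prod_comp σ (fun k => w + hA.eigenvalues k)]
    rw [← Finset.card_univ (α := Fin N), ← Finset.prod_const, ← Finset.prod_mul_distrib]
    refine Finset.prod_congr rfl fun k _ => ?_
    simp
    ring
  · rw [Equiv.sum_comp σ (fun k => hA.eigenvalues k), hA.trace_eq_sum_eigenvalues]
    simp

lemma dotProduct_mulVec_sum_smul {N : ℕ} {I : Type*} [Fintype I]
    (A : Matrix (Fin N) (Fin N) ℝ) (g : I → Fin N → ℝ)
    (hgA : ∀ i j, i ≠ j → g i ⬝ᵥ A *ᵥ g j = 0) (c : I → ℝ) :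
    (∑ i, c i • g i) ⬝ᵥ A *ᵥ (∑ i, c i • g i) = ∑ i, c i ^ 2 * (g i ⬝ᵥ A *ᵥ g i) := by
  classical
  rw [Matrix.mulVec_sum, sum_dotProduct]
  refine Finset.sum_congr rfl fun i _ => ?_
  rw [dotProduct_sum, Finset.sum_eq_single i]
  · rw [Matrix.mulVec_smul, smul_dotProduct, dotProduct_smul]
    simp only [smul_eq_mul]; ring
  · intro j _ hj
    rw [Matrix.mulVec_smul, smul_dotProduct, dotProduct_smul, hgA i j hj.symm]
    simp
  · simp

/-- Min-max principle: a quadratic form which is at most `t` on one subspace and at least `t'` on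
another one, of complementary dimensions overlapping, satisfies `t' ≤ t`. -/
lemma rayleigh_le_of_card {N : ℕ} {I J : Type*} [Fintype I] [Fintype J]
    (A : Matrix (Fin N) (Fin N) ℝ) (g : I → Fin N → ℝ) (h : J → Fin N → ℝ)
    (hcard : N < Fintype.card I + Fintype.card J) {t t' : ℝ}
    (hg : ∀ i, 0 < g i ⬝ᵥ g i) (hgo : ∀ i j, i ≠ j → g i ⬝ᵥ g j = 0)
    (hgA : ∀ i j, i ≠ j → g i ⬝ᵥ A *ᵥ g j = 0)
    (hgt : ∀ i, g i ⬝ᵥ A *ᵥ g i ≤ t * (g i ⬝ᵥ g i))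
    (hh : ∀ i, 0 < h i ⬝ᵥ h i) (hho : ∀ i j, i ≠ j → h i ⬝ᵥ h j = 0)
    (hhA : ∀ i j, i ≠ j → h i ⬝ᵥ A *ᵥ h j = 0)
    (hht : ∀ i, t' * (h i ⬝ᵥ h i) ≤ h i ⬝ᵥ A *ᵥ h i) : t' ≤ t := by
  classical
  have hdep : ¬ LinearIndependent ℝ (Sum.elim g h) := by
    intro hli
    have := hli.fintype_card_le_finrank
    simp at this
    omega
  obtain ⟨c, hc, k, hk⟩ := Fintype.not_linearIndependent_iff.1 hdep
  rw [Fintype.sum_sum_type] at hc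
  simp only [Sum.elim_inl, Sum.elim_inr] at hc
  set x := ∑ i, c (Sum.inl i) • g i with hx
  have hx' : x = ∑ j, (-c (Sum.inr j)) • h j := by
    simp only [neg_smul, Finset.sum_neg_distrib]
    exact eq_neg_of_add_eq_zero_left hc
  have one : ∀ v : Fin N → ℝ, (1 : Matrix (Fin N) (Fin N) ℝ) *ᵥ v = v := Matrix.one_mulVec
  have n1 : x ⬝ᵥ x = ∑ i, c (Sum.inl i) ^ 2 * (g i ⬝ᵥ g i) := by
    have := dotProduct_mulVec_sum_smul 1 g (by simpa [one] using hgo) fun i => c (Sum.inl i)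
    simpa only [one, ← hx] using this
  have n2 : x ⬝ᵥ x = ∑ j, c (Sum.inr j) ^ 2 * (h j ⬝ᵥ h j) := by
    have := dotProduct_mulVec_sum_smul 1 h (by simpa [one] using hho) fun i => -c (Sum.inr i)
    simpa only [one, ← hx', neg_sq] using this
  have q1 : x ⬝ᵥ A *ᵥ x ≤ t * (x ⬝ᵥ x) := by
    rw [n1, dotProduct_mulVec_sum_smul A g hgA, Finset.mul_sum]
    refine Finset.sum_le_sum fun i _ => ?_
    nlinarith [mul_le_mul_of_nonneg_left (hgt i) (sq_nonneg (c (Sum.inl i)))]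
  have q2 : t' * (x ⬝ᵥ x) ≤ x ⬝ᵥ A *ᵥ x := by
    rw [n2, hx', dotProduct_mulVec_sum_smul A h hhA, Finset.mul_sum]
    refine Finset.sum_le_sum fun i _ => ?_
    nlinarith [mul_le_mul_of_nonneg_left (hht i) (sq_nonneg (c (Sum.inr i)))]
  have pos : 0 < x ⬝ᵥ x := by
    rcases k with i | j
    · rw [n1]
      exact Finset.sum_pos' (fun i _ => mul_nonneg (sq_nonneg _) (hg i).le)
        ⟨i, Finset.mem_univ i, mul_pos (by positivity) (hg i)⟩
    · rw [n2]
      exact Finset.sum_pos' (fun i _ => mul_nonneg (sq_nonneg _) (hh i).le)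
        ⟨j, Finset.mem_univ j, mul_pos (by positivity) (hh j)⟩
  exact le_of_mul_le_mul_right (q2.trans q1) pos

lemma insertNth_zero_dotProduct {n : ℕ} (M : Fin (n + 1)) (f : Fin n → ℝ) (v : Fin (n + 1) → ℝ) :
    (M.insertNth (α := fun _ => ℝ) 0 f) ⬝ᵥ v = ∑ i, f i * v (M.succAbove i) := by
  simp [dotProduct, Fin.sum_univ_succAbove _ M]

lemma mulVec_insertNth_zero {n : ℕ} (A : Matrix (Fin (n + 1)) (Fin (n + 1)) ℝ) (M : Fin (n + 1))
    (f : Fin n → ℝ) (i : Fin n) : (A *ᵥ (M.insertNth (α := fun _ => ℝ) 0 f)) (M.succAbove i) =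
      (A.submatrix M.succAbove M.succAbove *ᵥ f) i := by
  simp [Matrix.mulVec, dotProduct, Fin.sum_univ_succAbove _ M]

/-- Cauchy interlacing for the deletion of one row and column. -/
lemma cauchy_interlacing {n : ℕ} (A : Matrix (Fin (n + 1)) (Fin (n + 1)) ℝ) (M : Fin (n + 1))
    {α : Fin (n + 1) → ℝ} {e : Fin (n + 1) → Fin (n + 1) → ℝ} (hα : Antitone α)
    (heo : ∀ i j, e i ⬝ᵥ e j = if i = j then 1 else 0) (he : ∀ k, A *ᵥ e k = α k • e k)
    {β : Fin n → ℝ} {f : Fin n → Fin n → ℝ} (hβ : Antitone β)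
    (hfo : ∀ i j, f i ⬝ᵥ f j = if i = j then 1 else 0)
    (hf : ∀ k, A.submatrix M.succAbove M.succAbove *ᵥ f k = β k • f k) (k : Fin n) :
    β k ≤ α k.castSucc ∧ α k.succ ≤ β k := by
  have he' : ∀ i j, e i ⬝ᵥ A *ᵥ e j = if i = j then α j else 0 := fun i j => by
    rw [he, dotProduct_smul, heo]; split_ifs <;> simp
  set F : Fin n → Fin (n + 1) → ℝ := fun i => M.insertNth (α := fun _ => ℝ) 0 (f i)
  have hFo : ∀ i j, F i ⬝ᵥ F j = if i = j then 1 else 0 := fun i j => by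
    simp only [F]
    rw [insertNth_zero_dotProduct, ← hfo]
    simp [dotProduct]
  have hF : ∀ i j, F i ⬝ᵥ A *ᵥ F j = if i = j then β j else 0 := fun i j => by
    simp only [F]
    rw [insertNth_zero_dotProduct]
    simp only [mulVec_insertNth_zero, hf]
    have := hfo i j
    calc ∑ x, f i x * (β j • f j) x = β j * (f i ⬝ᵥ f j) := by
          simp only [dotProduct, Finset.mul_sum, Pi.smul_apply, smul_eq_mul]
          exact Finset.sum_congr rfl fun x _ => by ring
      _ = _ := by rw [this]; split_ifs <;> simp
  have cardge : ∀ (m : ℕ) (a : Fin m), Fintype.card {i : Fin m // a ≤ i} = m - a := fun m a => by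
    rw [Fintype.card_subtype]; 
    have : Finset.univ.filter (fun i => a ≤ i) = Finset.Ici a := by ext; simp
    rw [this, Fin.card_Ici]
  have cardle : ∀ (m : ℕ) (a : Fin m), Fintype.card {i : Fin m // i ≤ a} = a + 1 := fun m a => by
    rw [Fintype.card_subtype]; 
    have : Finset.univ.filter (fun i => i ≤ a) = Finset.Iic a := by ext; simp
    rw [this, Fin.card_Iic]
  constructor
  · refine rayleigh_le_of_card A (fun i : {i : Fin (n + 1) // k.castSucc ≤ i} => e i)
      (fun i : {i : Fin n // i ≤ k} => F i) ?_ (fun i => ?_) (fun i j hij => ?_)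
      (fun i j hij => ?_) (fun i => ?_) (fun i => ?_) (fun i j hij => ?_) (fun i j hij => ?_)
      fun i => ?_
    · rw [cardge, cardle, Fin.val_castSucc]
      omega
    · simp [heo]
    · simp [heo, Subtype.coe_injective.ne hij]
    · simp [he', Subtype.coe_injective.ne hij]
    · simpa [heo, he'] using hα i.2
    · simp [hFo]
    · simp [hFo, Subtype.coe_injective.ne hij]
    · simp [hF, Subtype.coe_injective.ne hij]
    · simpa [hFo, hF] using hβ i.2
  · refine rayleigh_le_of_card A (fun i : {i : Fin n // k ≤ i} => F i)
      (fun i : {i : Fin (n + 1) // i ≤ k.succ} => e i) ?_ (fun i => ?_) (fun i j hij => ?_)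
      (fun i j hij => ?_) (fun i => ?_) (fun i => ?_) (fun i j hij => ?_) (fun i j hij => ?_)
      fun i => ?_
    · rw [cardge, cardle, Fin.val_succ]
      omega
    · simp [hFo]
    · simp [hFo, Subtype.coe_injective.ne hij]
    · simp [hF, Subtype.coe_injective.ne hij]
    · simpa [hFo, hF] using hβ i.2
    · simp [heo]
    · simp [heo, Subtype.coe_injective.ne hij]
    · simp [he', Subtype.coe_injective.ne hij]
    · simpa [heo, he'] using hα i.2

/-- Symmetric tridiagonal matrices with nonvanishing off-diagonal entries. -/
structure IsJacobi {n : ℕ} (A : Matrix (Fin (n + 1)) (Fin (n + 1)) ℝ) : Prop where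
  symm : Aᵀ = A
  tri : ∀ i j : Fin (n + 1), (i : ℕ) + 1 < j → A i j = 0
  off : ∀ i j : Fin (n + 1), (i : ℕ) + 1 = j → A i j ≠ 0

namespace IsJacobi

variable {n : ℕ} {A : Matrix (Fin (n + 1)) (Fin (n + 1)) ℝ}

lemma apply_comm (hA : IsJacobi A) (i j : Fin (n + 1)) : A i j = A j i :=
  congrFun (congrFun hA.symm j) i

lemma smul_one_add (hA : IsJacobi A) (w : ℝ) : IsJacobi (w • (1 : Matrix _ _ ℝ) + A) where
  symm := by rw [transpose_add, hA.symm, transpose_smul, transpose_one]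
  tri i j h := by
    have : i ≠ j := by rintro rfl; omega
    simp [hA.tri i j h, Matrix.one_apply_ne this]
  off i j h := by
    have : i ≠ j := by rintro rfl; omega
    simpa [Matrix.one_apply_ne this] using hA.off i j h

lemma eq_zero_of_mulVec_eq_zero (hA : IsJacobi A) {W : Fin (n + 1) → ℝ} (M : Fin (n + 1))
    (h0 : W 0 = 0) (hW : ∀ j < M, (A *ᵥ W) j = 0) : ∀ j ≤ M, W j = 0 := by
  intro j
  induction hm : (j : ℕ) using Nat.strong_induction_on generalizing j with
  | _ m ih =>
    intro hj
    rcases Nat.eq_zero_or_pos m with h | h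
    · have : j = 0 := Fin.ext (by simpa [hm] using h)
      rw [this, h0]
    · let i : Fin (n + 1) := ⟨m - 1, by omega⟩
      have hi : i < M := by
        rw [Fin.lt_def]; rw [Fin.le_def] at hj; simp only [i]; omega
      have e := hW i hi
      rw [Matrix.mulVec, dotProduct, Finset.sum_eq_single j] at e
      · exact (mul_eq_zero.1 e).resolve_left (hA.off i j (by simp only [i]; omega))
      · intro k _ hk
        rcases lt_or_ge (k : ℕ) m with h1 | h1
        · rw [ih k h1 k rfl (by rw [Fin.le_def] at *; omega), mul_zero]
        · have : (k : ℕ) ≠ m := fun h2 => hk (Fin.ext (h2.trans hm.symm))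
          rw [hA.tri i k (by simp only [i]; omega), zero_mul]
      · simp

lemma mulVec_adjugate_col (A : Matrix (Fin (n + 1)) (Fin (n + 1)) ℝ) (k j : Fin (n + 1)) :
    (A *ᵥ fun i => A.adjugate i k) j = if j = k then A.det else 0 := by
  have := congrFun (congrFun A.mul_adjugate j) k
  rw [Matrix.mul_apply] at this
  rw [Matrix.mulVec, dotProduct, this]
  simp [Matrix.one_apply]

lemma adjugate_comm (hA : IsJacobi A) (i j : Fin (n + 1)) : A.adjugate i j = A.adjugate j i := by
  have := congrFun (congrFun A.adjugate_transpose i) j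
  rw [hA.symm] at this
  exact this.symm

lemma adjugate_mul_adjugate (hA : IsJacobi A) (M : Fin (n + 1)) :
    A.adjugate 0 M * A.adjugate (Fin.last n) M = A.adjugate 0 (Fin.last n) * A.adjugate M M := by
  set W : Fin (n + 1) → ℝ := A.adjugate 0 M • (fun i => A.adjugate i (Fin.last n)) -
    A.adjugate 0 (Fin.last n) • (fun i => A.adjugate i M) with hWdef
  have hW := hA.eq_zero_of_mulVec_eq_zero (W := W) M (by simp [W]; ring) (fun j hj => by
    have h1 : j ≠ Fin.last n := (hj.trans_le (Fin.le_last M)).ne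
    simp only [hWdef, Matrix.mulVec_sub, Matrix.mulVec_smul, Pi.sub_apply, Pi.smul_apply,
      mulVec_adjugate_col, if_neg h1, if_neg hj.ne, smul_zero, sub_zero]) M le_rfl
  simp only [hWdef, Pi.sub_apply, Pi.smul_apply, smul_eq_mul] at hW
  rw [hA.adjugate_comm (Fin.last n) M]
  linarith

lemma adjugate_zero_last (hA : IsJacobi A) :
    A.adjugate 0 (Fin.last n) = (-1) ^ n * ∏ i : Fin n, A i.castSucc i.succ := by
  rw [Matrix.adjugate_fin_succ_eq_det_submatrix]
  rw [Matrix.det_of_isLowerTriangular]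
  · simp
  · intro i j hij
    have : i < j := hij
    simpa using hA.tri i.castSucc j.succ (by rw [Fin.lt_def] at this; simpa using this)

lemma adjugate_self (A : Matrix (Fin (n + 1)) (Fin (n + 1)) ℝ) (M : Fin (n + 1)) :
    A.adjugate M M = (A.submatrix M.succAbove M.succAbove).det := by
  rw [Matrix.adjugate_fin_succ_eq_det_submatrix, ← two_mul]
  simp

lemma smul_one_add_adjugate_zero_last (hA : IsJacobi A) (w : ℝ) :
    (w • (1 : Matrix _ _ ℝ) + A).adjugate 0 (Fin.last n) = A.adjugate 0 (Fin.last n) := by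
  rw [(hA.smul_one_add w).adjugate_zero_last, hA.adjugate_zero_last]
  congr 1
  refine Finset.prod_congr rfl fun i _ => ?_
  simp [Matrix.one_apply_ne (Fin.castSucc_lt_succ (i := i)).ne]

lemma det_smul_of_mulVec_eq (A : Matrix (Fin (n + 1)) (Fin (n + 1)) ℝ) {u : Fin (n + 1) → ℝ}
    {r : ℝ} {M : Fin (n + 1)} (hu : ∀ j, (A *ᵥ u) j = if j = M then r else 0) (i : Fin (n + 1)) :
    A.det * u i = r * A.adjugate i M := by
  have h1 : A.adjugate *ᵥ (A *ᵥ u) = A.det • u := by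
    rw [Matrix.mulVec_mulVec, Matrix.adjugate_mul, Matrix.smul_mulVec, Matrix.one_mulVec]
  have h2 := congrFun h1 i
  rw [Matrix.mulVec, dotProduct] at h2
  simp only [hu, mul_ite, mul_zero, Finset.sum_ite_eq', Finset.mem_univ, if_true, Pi.smul_apply,
    smul_eq_mul] at h2
  linarith

lemma mul_mul_det_submatrix (hA : IsJacobi A) (hdet : A.det ≠ 0) {u : Fin (n + 1) → ℝ}
    {M : Fin (n + 1)} (hu : ∀ j ≠ M, (A *ᵥ u) j = 0) :
    u 0 * u (Fin.last n) * (A.submatrix M.succAbove M.succAbove).det =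
      A.adjugate 0 (Fin.last n) * u M ^ 2 := by
  have hu' : ∀ j, (A *ᵥ u) j = if j = M then (A *ᵥ u) M else 0 := fun j => by
    split_ifs with h
    · rw [h]
    · exact hu j h
  have h := det_smul_of_mulVec_eq A hu'
  have key := hA.adjugate_mul_adjugate M
  rw [← adjugate_self]
  have h0 := h 0
  have h1 := h (Fin.last n)
  have h2 := h M
  refine mul_left_cancel₀ (pow_ne_zero 2 hdet) ?_
  generalize (A *ᵥ u) M = r at *
  calc A.det ^ 2 * (u 0 * u (Fin.last n) * A.adjugate M M)
      = (A.det * u 0) * (A.det * u (Fin.last n)) * A.adjugate M M := by ring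
    _ = r ^ 2 * (A.adjugate 0 M * A.adjugate (Fin.last n) M) * A.adjugate M M := by
        rw [h0, h1]; ring
    _ = A.adjugate 0 (Fin.last n) * (r * A.adjugate M M) ^ 2 := by rw [key]; ring
    _ = _ := by rw [← h2]; ring

/-- The adjugate of a Jacobi matrix with a positive unit kernel vector has rank one. -/
lemma adjugate_eq (hA : IsJacobi A) {ρ : Fin (n + 1) → ℝ} (hρ : ∀ i, 0 < ρ i) (hρA : A *ᵥ ρ = 0)
    (hρ1 : ∑ i, ρ i ^ 2 = 1) {lam : Fin n → ℝ}
    (hdet : ∀ w : ℝ, (w • (1 : Matrix _ _ ℝ) + A).det = w * ∏ k, (w + lam k))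
    (i j : Fin (n + 1)) : A.adjugate i j = (∏ k, lam k) * ρ i * ρ j := by
  have d0 : A.det = 0 := by simpa using hdet 0
  have rank : ∀ i j, A.adjugate i j * ρ 0 = A.adjugate 0 j * ρ i := by
    intro i j
    have := hA.eq_zero_of_mulVec_eq_zero
      (W := ρ 0 • (fun i => A.adjugate i j) - A.adjugate 0 j • ρ) (Fin.last n)
      (by simp [mul_comm]) (fun k _ => by
        simp [Matrix.mulVec_sub, Matrix.mulVec_smul, mulVec_adjugate_col, d0, hρA]) i
      (Fin.le_last i)
    simp at this
    linarith
  have hsum : ∀ w : ℝ, ∑ j, (w • (1 : Matrix _ _ ℝ) + A).adjugate 0 j * ρ j =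
      (∏ k, (w + lam k)) * ρ 0 := by
    suffices h : (fun w : ℝ => ∑ j, (w • (1 : Matrix _ _ ℝ) + A).adjugate 0 j * ρ j) =
        fun w => (∏ k, (w + lam k)) * ρ 0 from congrFun h
    refine Continuous.ext_on (dense_compl_singleton (0 : ℝ)) ?_ ?_ ?_
    · refine continuous_finsetSum _ fun j _ => Continuous.mul ?_ continuous_const
      exact (Continuous.matrix_adjugate (by fun_prop)).matrix_elem 0 j
    · fun_prop
    · intro w hw
      have hw : w ≠ 0 := hw
      set S := w • (1 : Matrix (Fin (n + 1)) (Fin (n + 1)) ℝ) + A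
      have h1 : S *ᵥ ρ = w • ρ := by
        simp [S, Matrix.add_mulVec, hρA, Matrix.smul_mulVec]
      have h2 : S.adjugate *ᵥ (S *ᵥ ρ) = S.det • ρ := by
        rw [Matrix.mulVec_mulVec, Matrix.adjugate_mul, Matrix.smul_mulVec, Matrix.one_mulVec]
      rw [h1, Matrix.mulVec_smul] at h2
      have h3 := congrFun h2 0
      simp only [Pi.smul_apply, smul_eq_mul, hdet, S] at h3
      rw [mul_assoc] at h3
      exact mul_left_cancel₀ hw h3
  have h0 := hsum 0
  simp only [zero_smul, zero_add] at h0
  have e1 : A.adjugate 0 0 = (∏ k, lam k) * ρ 0 * ρ 0 := by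
    calc A.adjugate 0 0 = A.adjugate 0 0 * ∑ j, ρ j ^ 2 := by rw [hρ1, mul_one]
      _ = (∑ j, A.adjugate 0 j * ρ j) * ρ 0 := by
        rw [Finset.mul_sum, Finset.sum_mul]
        refine Finset.sum_congr rfl fun j _ => ?_
        have := rank j 0
        rw [hA.adjugate_comm j 0] at this
        linear_combination -ρ j * this
      _ = _ := by rw [h0]
  have hp := (hρ 0).ne'
  have r1 := rank i j
  have r2 := rank j 0
  rw [hA.adjugate_comm j 0] at r2
  refine mul_right_cancel₀ (pow_ne_zero 2 hp) ?_
  calc A.adjugate i j * ρ 0 ^ 2 = (A.adjugate i j * ρ 0) * ρ 0 := by ring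
    _ = (A.adjugate 0 j * ρ 0) * ρ i := by rw [r1]; ring
    _ = _ := by rw [r2, e1]; ring

/-- A test function which is a local eigenfunction on its support bounds the spectral gap. -/
lemma gap_le (hA : IsJacobi A) {ρ : Fin (n + 1) → ℝ} (hρA : A *ᵥ ρ = 0)
    (hρ1 : ∑ i, ρ i ^ 2 = 1) {e : Fin n → Fin (n + 1) → ℝ} {lam : Fin n → ℝ}
    (heo : ∀ i j, e i ⬝ᵥ e j = if i = j then 1 else 0) (he : ∀ k, A *ᵥ e k = lam k • e k)
    {l b κ : ℝ} (hl : ∀ k, l ≤ lam k) (hb : 0 ≤ b) (hκ : 0 < κ) {ψ : Fin (n + 1) → ℝ}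
    (hψ : ψ ≠ 0) (hψA : ∀ j, ψ j * (A *ᵥ ψ) j = b * ψ j ^ 2)
    (hmass : κ ≤ ∑ j, if ψ j = 0 then ρ j ^ 2 else 0) : κ * l ≤ b := by
  have sq : ∀ v : Fin (n + 1) → ℝ, v ⬝ᵥ v = ∑ j, v j ^ 2 := fun v =>
    Finset.sum_congr rfl fun j _ => by ring
  have selfadj : ∀ v, ρ ⬝ᵥ A *ᵥ v = 0 := fun v => by
    rw [Matrix.dotProduct_mulVec, ← Matrix.mulVec_transpose, hA.symm, hρA, zero_dotProduct]
  set a := ψ ⬝ᵥ ρ with ha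
  set χ := ψ - a • ρ with hχ
  have hρρ : ρ ⬝ᵥ ρ = 1 := by rw [sq, hρ1]
  have hρχ : ρ ⬝ᵥ χ = 0 := by
    rw [hχ, dotProduct_sub, dotProduct_smul, hρρ, dotProduct_comm ρ ψ]
    simp [ha]
  have hAχ : A *ᵥ χ = A *ᵥ ψ := by rw [hχ, Matrix.mulVec_sub, Matrix.mulVec_smul, hρA]; simp
  have hψψ : 0 < ψ ⬝ᵥ ψ := by
    rw [sq]
    obtain ⟨j, hj⟩ := Function.ne_iff.1 hψ
    have hj : ψ j ≠ 0 := hj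
    exact Finset.sum_pos' (fun i _ => sq_nonneg _) ⟨j, Finset.mem_univ j, by positivity⟩
  have hχA : χ ⬝ᵥ A *ᵥ χ = b * (ψ ⬝ᵥ ψ) := by
    rw [hAχ, hχ, sub_dotProduct, smul_dotProduct, selfadj, sq, dotProduct, Finset.mul_sum]
    simp [hψA]
  have hχχ : χ ⬝ᵥ χ = ψ ⬝ᵥ ψ - a ^ 2 := by
    have : χ ⬝ᵥ χ = ψ ⬝ᵥ χ - a * (ρ ⬝ᵥ χ) := by
      conv_lhs => rw [hχ, sub_dotProduct, ← hχ, smul_dotProduct, smul_eq_mul]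
    rw [this, hρχ, hχ, dotProduct_sub, dotProduct_smul, ← ha, smul_eq_mul]
    ring
  have cs : a ^ 2 ≤ (ψ ⬝ᵥ ψ) * (1 - κ) := by
    have e1 : a = ∑ j, ψ j * (if ψ j = 0 then 0 else ρ j) :=
      Finset.sum_congr rfl fun j _ => by split_ifs with h <;> simp [h]
    have e2 := Finset.sum_mul_sq_le_sq_mul_sq Finset.univ ψ fun j => if ψ j = 0 then 0 else ρ j
    rw [← e1, ← sq] at e2
    refine e2.trans (mul_le_mul_of_nonneg_left ?_ hψψ.le)
    have e3 : ∑ j, (if ψ j = 0 then 0 else ρ j) ^ 2 + ∑ j, (if ψ j = 0 then ρ j ^ 2 else 0) = 1 := by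
      rw [← Finset.sum_add_distrib, ← hρ1]
      exact Finset.sum_congr rfl fun j _ => by split_ifs <;> simp
    linarith
  have hχκ : κ * (ψ ⬝ᵥ ψ) ≤ χ ⬝ᵥ χ := by rw [hχχ]; linarith
  have hχpos : 0 < χ ⬝ᵥ χ := lt_of_lt_of_le (by positivity) hχκ
  have key : l ≤ b / κ := by
    refine rayleigh_le_of_card A (fun i : Bool => if i then ρ else χ) e (by simp; omega)
      ?_ ?_ ?_ ?_ (fun i => by simp [heo]) (fun i j hij => by simp [heo, hij])
      (fun i j hij => by rw [he, dotProduct_smul, heo]; simp [hij])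
      (fun i => by rw [he, dotProduct_smul, heo]; simpa using hl i)
    · rintro (_ | _)
      · simpa using hχpos
      · simp [hρρ]
    · rintro (_ | _) (_ | _) h <;> simp at h ⊢
      · rw [dotProduct_comm, hρχ]
      · exact hρχ
    · rintro (_ | _) (_ | _) h <;> simp at h ⊢
      · rw [hρA, dotProduct_zero]
      · exact selfadj _
    · rintro (_ | _)
      · simp only [Bool.false_eq_true, if_false]
        rw [hχA, div_mul_eq_mul_div, le_div_iff₀ hκ]
        nlinarith [mul_le_mul_of_nonneg_left hχκ hb]
      · simp only [if_true]
        rw [hρA, dotProduct_zero, hρρ, mul_one]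
        positivity
  rw [le_div_iff₀ hκ] at key
  linarith

end IsJacobi

/-- Spectral data of a Jacobi matrix `A` with positive unit kernel vector `ρ`: the nonzero
eigenvalues `lam` of `A` and the eigenvalues `bet` of `A` with row and column `M` deleted. -/
structure JacobiData {n : ℕ} (A : Matrix (Fin (n + 1)) (Fin (n + 1)) ℝ) (ρ : Fin (n + 1) → ℝ)
    (M : Fin (n + 1)) (κ : ℝ) (lam bet : Fin n → ℝ) : Prop where
  lam_pos : ∀ k, 0 < lam k
  lam_le : ∀ k, lam k ≤ 2
  bet_pos : ∀ k, 0 < bet k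
  bet_le : ∀ k, bet k ≤ lam k
  sum_lam : ∑ k, lam k = A.trace
  sum_bet : ∑ k, bet k = A.trace - A M M
  gap_le_bet : ∀ l, (∀ k, l ≤ lam k) → ∀ k, κ * l ≤ bet k
  sum_inv_le : ∀ l, 0 < l → (∀ k, l ≤ lam k) → ∑ k, 1 / bet k ≤ ∑ k, 1 / lam k + 1 / (κ * l)
  lam_mem : ∀ k, ∃ v, v ≠ 0 ∧ A *ᵥ v = lam k • v
  mem_lam : ∀ x ≠ 0, (∃ v, v ≠ 0 ∧ A *ᵥ v = x • v) → ∃ k, x = lam k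
  bet_eq : ∀ w : ℝ, 0 < w → ∀ u : Fin (n + 1) → ℝ,
    (∀ j ≠ M, ((w • (1 : Matrix _ _ ℝ) + A) *ᵥ u) j = 0) →
      u 0 * u (Fin.last n) * (∏ k, (w + bet k)) * ρ M ^ 2 =
        ρ 0 * ρ (Fin.last n) * (∏ k, bet k) * u M ^ 2
  lam_eq : ∀ w : ℝ, 0 < w → ∀ (r : ℝ) (h : Fin (n + 1) → ℝ),
    (∀ j, ((w • (1 : Matrix _ _ ℝ) + A) *ᵥ h) j = if j = Fin.last n then r else 0) →
      w * (∏ k, (w + lam k)) * h 0 = r * ((∏ k, lam k) * ρ 0 * ρ (Fin.last n))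

lemma sorted_sum_inv_le {n : ℕ} {al : Fin (n + 1) → ℝ} {bet : Fin n → ℝ} {b : ℝ}
    (hal : ∀ k : Fin n, 0 < al k.castSucc) (hb : 0 < b)
    (h : ∀ k, al k.succ ≤ bet k) (hbet : ∀ k, b ≤ bet k) :
    ∑ k, 1 / bet k ≤ ∑ k : Fin n, 1 / al k.castSucc + 1 / b := by
  rcases n with _ | N
  · simpa using hb.le
  rw [Fin.sum_univ_castSucc, Fin.sum_univ_succ (fun k : Fin (N + 1) => 1 / al k.castSucc)]
  have h1 : ∑ k : Fin N, 1 / bet k.castSucc ≤ ∑ k : Fin N, 1 / al k.succ.castSucc := by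
    refine Finset.sum_le_sum fun k _ => one_div_le_one_div_of_le (hal _) ?_
    have := h k.castSucc
    rwa [Fin.succ_castSucc] at this
  have h2 : 1 / bet (Fin.last N) ≤ 1 / b := one_div_le_one_div_of_le hb (hbet _)
  have h3 : 0 < 1 / al (0 : Fin (N + 1)).castSucc := by have := hal 0; positivity
  linarith

lemma IsJacobi.exists_data {n : ℕ} {A : Matrix (Fin (n + 1)) (Fin (n + 1)) ℝ} (hA : IsJacobi A)
    {ρ : Fin (n + 1) → ℝ} (hρ : ∀ i, 0 < ρ i) (hρA : A *ᵥ ρ = 0) (hρ1 : ∑ i, ρ i ^ 2 = 1)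
    (hspec : ∀ (x : ℝ) (v : Fin (n + 1) → ℝ), v ≠ 0 → A *ᵥ v = x • v → 0 ≤ x ∧ x ≤ 2)
    (M : Fin (n + 1)) {κ : ℝ} (hκ : 0 < κ) (hlow : κ ≤ ∑ j, if j ≤ M then ρ j ^ 2 else 0)
    (hhigh : κ ≤ ∑ j, if M ≤ j then ρ j ^ 2 else 0) :
    ∃ lam bet : Fin n → ℝ, JacobiData A ρ M κ lam bet := by
  have herm : A.IsHermitian := by
    rw [Matrix.IsHermitian, Matrix.conjTranspose_eq_transpose_of_trivial, hA.symm]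
  set B := A.submatrix M.succAbove M.succAbove with hB
  have hermB : B.IsHermitian := herm.submatrix _
  obtain ⟨al, e, hal, heo, he, hdet, htr⟩ := exists_sorted_eigenbasis A herm
  obtain ⟨bet, f, hbet, hfo, hf, hdetB, htrB⟩ := exists_sorted_eigenbasis B hermB
  have inter := cauchy_interlacing A M hal heo he hbet hfo hf
  have ne0 : ∀ k, e k ≠ 0 := fun k h => by have := heo k k; simp [h] at this
  have fne0 : ∀ k, f k ≠ 0 := fun k h => by have := hfo k k; simp [h] at this
  have al_nonneg : ∀ k, 0 ≤ al k := fun k => (hspec _ _ (ne0 k) (he k)).1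
  have bet_nonneg : ∀ k, 0 ≤ bet k := fun k => (al_nonneg _).trans (inter k).2
  have mem_al : ∀ x : ℝ, (∃ v, v ≠ 0 ∧ A *ᵥ v = x • v) → ∃ k, x = al k := by
    rintro x ⟨v, hv, hAv⟩
    have h0 : ((-x) • (1 : Matrix _ _ ℝ) + A).det = 0 := by
      rw [← Matrix.exists_mulVec_eq_zero_iff]
      refine ⟨v, hv, ?_⟩
      rw [Matrix.add_mulVec, hAv, Matrix.smul_mulVec, Matrix.one_mulVec]
      simp
    rw [hdet, Finset.prod_eq_zero_iff] at h0
    obtain ⟨k, _, hk⟩ := h0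
    exact ⟨k, by linarith⟩
  have hρ0 : ρ ≠ 0 := fun h => by have := hρ 0; simp [h] at this
  have al_last : al (Fin.last n) = 0 := by
    obtain ⟨k, hk⟩ := mem_al 0 ⟨ρ, hρ0, by simp [hρA]⟩
    exact le_antisymm ((hal (Fin.le_last k)).trans_eq hk.symm) (al_nonneg _)
  have hdet' : ∀ w : ℝ, (w • (1 : Matrix _ _ ℝ) + A).det = w * ∏ k : Fin n, (w + al k.castSucc) :=
    fun w => by rw [hdet, Fin.prod_univ_castSucc, al_last, add_zero, mul_comm]
  have hadj := hA.adjugate_eq hρ hρA hρ1 hdet'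
  have hP : ∏ k : Fin n, al k.castSucc ≠ 0 := by
    intro h0
    have h1 := hA.adjugate_zero_last
    rw [hadj, h0, zero_mul, zero_mul] at h1
    have : (-1 : ℝ) ^ n * ∏ i : Fin n, A i.castSucc i.succ ≠ 0 :=
      mul_ne_zero (by simp) (Finset.prod_ne_zero_iff.2 fun i _ => hA.off _ _ (by simp))
    exact this h1.symm
  have lam_pos : ∀ k : Fin n, 0 < al k.castSucc := fun k =>
    lt_of_le_of_ne (al_nonneg _) (Finset.prod_ne_zero_iff.1 hP k (Finset.mem_univ _)).symm
  have hPB : ∏ k, bet k = (∏ k : Fin n, al k.castSucc) * ρ M ^ 2 := by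
    have h1 := hdetB 0
    simp only [zero_smul, zero_add] at h1
    rw [← h1, hB, ← IsJacobi.adjugate_self, hadj]
    ring
  have bet_pos : ∀ k, 0 < bet k := fun k => by
    refine lt_of_le_of_ne (bet_nonneg _) (Ne.symm ?_)
    have : ∏ k, bet k ≠ 0 := by rw [hPB]; exact mul_ne_zero hP (pow_ne_zero 2 (hρ M).ne')
    exact Finset.prod_ne_zero_iff.1 this k (Finset.mem_univ _)
  have det_pos : ∀ w : ℝ, 0 < w → (w • (1 : Matrix _ _ ℝ) + A).det ≠ 0 := fun w hw => by
    rw [hdet']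
    exact (mul_pos hw (Finset.prod_pos fun k _ => add_pos hw (lam_pos k))).ne'
  have gap : ∀ l, (∀ k : Fin n, l ≤ al k.castSucc) → ∀ k, κ * l ≤ bet k := by
    intro l hl k
    set φ : Fin (n + 1) → ℝ := M.insertNth (α := fun _ => ℝ) 0 (f k) with hφ
    have φM : φ M = 0 := by simp [φ]
    have φA : ∀ j ≠ M, (A *ᵥ φ) j = bet k * φ j := by
      intro j hj
      obtain ⟨i, rfl⟩ := Fin.exists_succAbove_eq hj
      rw [hφ, mulVec_insertNth_zero, ← hB, hf]
      simp
    have tri' : ∀ i j : Fin (n + 1), (j : ℕ) + 1 < i → A i j = 0 := fun i j h => by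
      rw [hA.apply_comm]; exact hA.tri j i h
    have main : ∀ (P : Fin (n + 1) → Prop) [DecidablePred P], ¬ P M →
        (∀ i j, P i → A i j ≠ 0 → j ≠ M → P j) → (∃ j, P j ∧ φ j ≠ 0) →
        κ ≤ (∑ j, if P j then 0 else ρ j ^ 2) → κ * l ≤ bet k := by
      intro P _ hPM hPc ⟨j0, hj0, hj0'⟩ hmass
      refine hA.gap_le hρA hρ1 (e := fun k => e k.castSucc) (lam := fun k => al k.castSucc)
        (fun i j => by rw [heo]; simp) (fun k => he _) hl (bet_nonneg k) hκ
        (ψ := fun j => if P j then φ j else 0) ?_ ?_ ?_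
      · intro h
        have := congrFun h j0
        simp [hj0] at this
        exact hj0' this
      · intro j
        by_cases hj : P j
        · have hjM : j ≠ M := by rintro rfl; exact hPM hj
          have e1 : (A *ᵥ fun j => if P j then φ j else 0) j = (A *ᵥ φ) j := by
            simp only [Matrix.mulVec, dotProduct]
            refine Finset.sum_congr rfl fun i _ => ?_
            by_cases hi : P i
            · simp [hi]
            · by_cases h0 : A j i = 0
              · simp [h0]
              · have : i = M := by
                  by_contra hne
                  exact hi (hPc j i hj h0 hne)
                simp [this, φM]
          rw [e1, φA j hjM]
          simp only [hj, if_true]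
          ring
        · simp [hj]
      · refine hmass.trans (Finset.sum_le_sum fun j _ => ?_)
        by_cases hj : P j
        · simp only [hj, if_true]
          split_ifs <;> positivity
        · simp [hj]
    obtain ⟨i, hi⟩ := Function.ne_iff.1 (fne0 k)
    have hi' : φ (M.succAbove i) ≠ 0 := by simpa [φ] using hi
    rcases lt_or_gt_of_ne (Fin.succAbove_ne M i) with h | h
    · refine main (fun j => j < M) (lt_irrefl M) (fun i j h1 h2 h3 => ?_) ⟨_, h, hi'⟩ ?_
      · by_contra h4
        refine h2 (hA.tri i j ?_)
        have h5 : M < j := lt_of_le_of_ne (not_lt.1 h4) (Ne.symm h3)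
        have h1 : i < M := h1
        rw [Fin.lt_def] at h1 h5
        omega
      · refine hhigh.trans_eq (Finset.sum_congr rfl fun j _ => ?_)
        by_cases h1 : j < M
        · simp [h1]
        · simp [h1, not_lt.1 h1]
    · refine main (fun j => M < j) (lt_irrefl M) (fun i j h1 h2 h3 => ?_) ⟨_, h, hi'⟩ ?_
      · by_contra h4
        refine h2 (tri' i j ?_)
        have h5 : j < M := lt_of_le_of_ne (not_lt.1 h4) h3
        have h1 : M < i := h1
        rw [Fin.lt_def] at h1 h5
        omega
      · refine hlow.trans_eq (Finset.sum_congr rfl fun j _ => ?_)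
        by_cases h1 : M < j
        · simp [h1]
        · simp [h1, not_lt.1 h1]
  refine ⟨fun k => al k.castSucc, bet, lam_pos, fun k => (hspec _ _ (ne0 _) (he _)).2, bet_pos,
    fun k => (inter k).1, ?_, ?_, gap, ?_, fun k => ⟨_, ne0 _, he _⟩, ?_, ?_, ?_⟩
  · rw [htr, Fin.sum_univ_castSucc, al_last, add_zero]
  · rw [← htrB, Matrix.trace, Matrix.trace, Fin.sum_univ_succAbove _ M]
    simp [hB]
  · intro l hl hle
    exact sorted_sum_inv_le lam_pos (mul_pos hκ hl) (fun k => (inter k).2) (gap l hle)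
  · intro x hx hv
    obtain ⟨k, hk⟩ := mem_al x hv
    rcases Fin.eq_castSucc_or_eq_last k with ⟨i, rfl⟩ | rfl
    · exact ⟨i, hk⟩
    · exact absurd (hk.trans al_last) hx
  · intro w hw u hu
    have h1 := (hA.smul_one_add w).mul_mul_det_submatrix (det_pos w hw) hu
    rw [hA.smul_one_add_adjugate_zero_last, hadj] at h1
    have h2 : (w • (1 : Matrix _ _ ℝ) + A).submatrix M.succAbove M.succAbove = w • 1 + B := by
      ext i j
      simp [hB, Matrix.one_apply]
    rw [h2, hdetB] at h1
    rw [h1, hPB]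
    ring
  · intro w hw r h hh
    have h1 := IsJacobi.det_smul_of_mulVec_eq _ hh 0
    rwa [hdet', hA.smul_one_add_adjugate_zero_last, hadj] at h1

/-- Generating function of the orbit of a bounded vector under a matrix. -/
lemma tsum_orbit_eq {N : ℕ} (Q : Matrix (Fin N) (Fin N) ℝ) (v : ℕ → Fin N → ℝ)
    (hv0 : ∀ m j, 0 ≤ v m j) (hv1 : ∀ m j, v m j ≤ 1) {j : Fin N}
    (hv : ∀ m, v (m + 1) j = ∑ k, Q j k * v m k) {x : ℝ} (hx : x ∈ Set.Ioo (0 : ℝ) 1) :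
    ∑' m, v m j * x ^ m = v 0 j + x * ∑ k, Q j k * ∑' m, v m k * x ^ m := by
  have hs : ∀ k, Summable fun m => v m k * x ^ m := fun k =>
    Summable.of_nonneg_of_le (fun m => mul_nonneg (hv0 m k) (pow_nonneg hx.1.le m))
      (fun m => mul_le_of_le_one_left (pow_nonneg hx.1.le m) (hv1 m k))
      (summable_geometric_of_lt_one hx.1.le hx.2)
  rw [(hs j).tsum_eq_zero_add, pow_zero, mul_one]
  congr 1
  calc ∑' m, v (m + 1) j * x ^ (m + 1) = ∑' m, ∑ k, x * (Q j k * (v m k * x ^ m)) := by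
        refine tsum_congr fun m => ?_
        rw [hv, Finset.sum_mul]
        exact Finset.sum_congr rfl fun k _ => by ring
    _ = ∑ k, ∑' m, x * (Q j k * (v m k * x ^ m)) :=
        Summable.tsum_finsetSum fun k _ => ((hs k).mul_left _).mul_left _
    _ = _ := by simp_rw [tsum_mul_left, Finset.mul_sum]

namespace BDChain

variable {n : ℕ} (c : BDChain n)

lemma K_eq_zero_of_lt {i j : Fin (n + 1)} (h : (i : ℕ) + 1 < j) : c.K i j = 0 :=
  c.K_tridiag i j (by rw [lt_abs]; omega)

lemma K_eq_zero_of_gt {i j : Fin (n + 1)} (h : (j : ℕ) + 1 < i) : c.K i j = 0 :=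
  c.K_tridiag i j (by rw [lt_abs]; omega)

lemma K_pos_up {i j : Fin (n + 1)} (h : (i : ℕ) + 1 = j) : 0 < c.K i j := by
  have hi : (i : ℕ) < n := by omega
  have := (c.K_irred i hi).1
  convert this using 2
  exact Fin.ext h.symm

lemma K_pos_down {i j : Fin (n + 1)} (h : (j : ℕ) + 1 = i) : 0 < c.K i j := by
  have hi : (j : ℕ) < n := by omega
  have := (c.K_irred j hi).2
  convert this using 1
  congr 1
  exact Fin.ext h.symm

lemma reversible_adjacent (m : ℕ) : ∀ i j : Fin (n + 1), (i : ℕ) = m → (j : ℕ) = m + 1 →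
    c.pi i * c.K i j = c.pi j * c.K j i := by
  induction m using Nat.strong_induction_on with
  | _ m ih =>
    intro i j hi hj
    have hs : ∑ k, (c.pi i * c.K i k - c.pi k * c.K k i) = 0 := by
      rw [Finset.sum_sub_distrib, ← Finset.mul_sum, c.K_rowSum, c.pi_stat]
      ring
    rw [Finset.sum_eq_single j] at hs
    · linarith
    · intro k _ hk
      have hk' : (k : ℕ) ≠ m + 1 := fun h => hk (Fin.ext (h.trans hj.symm))
      rcases lt_trichotomy (k : ℕ) m with h | h | h
      · by_cases h' : (k : ℕ) + 1 = m
        · rw [ih k (by omega) k i rfl (by omega), sub_self]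
        · rw [c.K_eq_zero_of_gt (i := i) (j := k) (by omega),
            c.K_eq_zero_of_lt (i := k) (j := i) (by omega)]
          simp
      · rw [show k = i from Fin.ext (h.trans hi.symm), sub_self]
      · rw [c.K_eq_zero_of_lt (i := i) (j := k) (by omega),
          c.K_eq_zero_of_gt (i := k) (j := i) (by omega)]
        simp
    · simp

lemma reversible (i j : Fin (n + 1)) : c.pi i * c.K i j = c.pi j * c.K j i := by
  rcases lt_trichotomy (i : ℕ) j with h | h | h
  · by_cases h' : (i : ℕ) + 1 = j
    · exact c.reversible_adjacent i i j rfl h'.symm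
    · rw [c.K_eq_zero_of_lt (i := i) (j := j) (by omega),
        c.K_eq_zero_of_gt (i := j) (j := i) (by omega)]
      simp
  · rw [Fin.ext h]
  · by_cases h' : (j : ℕ) + 1 = i
    · exact (c.reversible_adjacent j j i rfl h'.symm).symm
    · rw [c.K_eq_zero_of_lt (i := j) (j := i) (by omega),
        c.K_eq_zero_of_gt (i := i) (j := j) (by omega)]
      simp

/-- The square root of the stationary distribution. -/
def sqrtPi (i : Fin (n + 1)) : ℝ := Real.sqrt (c.pi i)

lemma sqrtPi_pos (i : Fin (n + 1)) : 0 < c.sqrtPi i := Real.sqrt_pos.2 (c.pi_pos i)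

lemma sqrtPi_sq (i : Fin (n + 1)) : c.sqrtPi i ^ 2 = c.pi i := Real.sq_sqrt (c.pi_pos i).le

/-- The matrix `I - K`, symmetrized. -/
def symMat : Matrix (Fin (n + 1)) (Fin (n + 1)) ℝ :=
  Matrix.of fun i j => c.sqrtPi i * (1 - c.K) i j / c.sqrtPi j

lemma symMat_mulVec (g : Fin (n + 1) → ℝ) (i : Fin (n + 1)) :
    (c.symMat *ᵥ fun j => c.sqrtPi j * g j) i = c.sqrtPi i * ((1 - c.K) *ᵥ g) i := by
  simp only [Matrix.mulVec, dotProduct, symMat, Matrix.of_apply, Finset.mul_sum]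
  refine Finset.sum_congr rfl fun j _ => ?_
  have := (c.sqrtPi_pos j).ne'
  field_simp

lemma smul_one_add_symMat_mulVec (w : ℝ) (g : Fin (n + 1) → ℝ) (i : Fin (n + 1)) :
    ((w • (1 : Matrix _ _ ℝ) + c.symMat) *ᵥ fun j => c.sqrtPi j * g j) i =
      c.sqrtPi i * ((w + 1) * g i - ∑ k, c.K i k * g k) := by
  rw [Matrix.add_mulVec, Pi.add_apply, symMat_mulVec, Matrix.sub_mulVec, Matrix.smul_mulVec,
    Matrix.one_mulVec, Matrix.one_mulVec]
  simp only [Pi.smul_apply, Pi.sub_apply, smul_eq_mul, Matrix.mulVec, dotProduct]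
  ring

lemma isJacobi_symMat : IsJacobi c.symMat where
  symm := by
    ext i j
    have hi := (c.sqrtPi_pos i).ne'
    have hj := (c.sqrtPi_pos j).ne'
    have h := c.reversible i j
    rw [← c.sqrtPi_sq, ← c.sqrtPi_sq] at h
    simp only [symMat, Matrix.transpose_apply, Matrix.of_apply, Matrix.sub_apply]
    rcases eq_or_ne i j with rfl | hij
    · rfl
    · rw [Matrix.one_apply_ne hij, Matrix.one_apply_ne hij.symm]
      field_simp
      linear_combination h
  tri i j h := by
    have : i ≠ j := by rintro rfl; omega
    simp [symMat, Matrix.one_apply_ne this, c.K_eq_zero_of_lt h]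
  off i j h := by
    have hij : i ≠ j := by rintro rfl; omega
    simp [symMat, Matrix.one_apply_ne hij, (c.K_pos_up h).ne', (c.sqrtPi_pos _).ne']

lemma symMat_mulVec_sqrtPi : c.symMat *ᵥ c.sqrtPi = 0 := by
  ext i
  have := c.symMat_mulVec (fun _ => 1) i
  simp only [mul_one] at this
  rw [show c.symMat *ᵥ c.sqrtPi = c.symMat *ᵥ fun j => c.sqrtPi j from rfl, this,
    Matrix.sub_mulVec, Matrix.one_mulVec]
  simp [Matrix.mulVec, dotProduct, c.K_rowSum]

lemma symMat_eig_iff (x : ℝ) : (∃ v, v ≠ 0 ∧ c.symMat *ᵥ v = x • v) ↔ x ∈ eigSet (1 - c.K) := by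
  constructor
  · rintro ⟨v, hv, h⟩
    have hv' : v = fun j => c.sqrtPi j * (v j / c.sqrtPi j) := by
      ext j
      have := (c.sqrtPi_pos j).ne'
      field_simp
    refine ⟨fun j => v j / c.sqrtPi j, fun h0 => hv ?_, ?_⟩
    · rw [hv']
      ext j
      have := congrFun h0 j
      simp only [Pi.zero_apply] at this
      simp [this]
    · ext i
      have h1 := congrFun h i
      have hi := (c.sqrtPi_pos i).ne'
      conv_lhs at h1 => rw [hv']
      rw [symMat_mulVec] at h1
      refine mul_left_cancel₀ hi (h1.trans ?_)
      simp only [Pi.smul_apply, smul_eq_mul]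
      field_simp
  · rintro ⟨g, hg, h⟩
    refine ⟨fun j => c.sqrtPi j * g j, fun h0 => hg ?_, ?_⟩
    · ext j
      have := congrFun h0 j
      simpa [(c.sqrtPi_pos j).ne'] using this
    · ext i
      rw [symMat_mulVec, h]
      simp only [Pi.smul_apply, smul_eq_mul]
      ring

lemma eig_mem_Icc {x : ℝ} (hx : x ∈ eigSet (1 - c.K)) : 0 ≤ x ∧ x ≤ 2 := by
  obtain ⟨g, hg, h⟩ := hx
  obtain ⟨i, -, hi⟩ := Finset.exists_max_image Finset.univ (fun j => |g j|) ⟨0, Finset.mem_univ 0⟩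
  have hpos : 0 < |g i| := by
    obtain ⟨j, hj⟩ := Function.ne_iff.1 hg
    exact (abs_pos.2 hj).trans_le (hi j (Finset.mem_univ j))
  have h1 := congrFun h i
  rw [Matrix.sub_mulVec, Matrix.one_mulVec] at h1
  simp only [Pi.smul_apply, Pi.sub_apply, smul_eq_mul, Matrix.mulVec, dotProduct] at h1
  have h2 : |(1 - x) * g i| ≤ |g i| := by
    rw [show (1 - x) * g i = ∑ k, c.K i k * g k by linarith]
    refine (Finset.abs_sum_le_sum_abs _ _).trans ?_
    calc ∑ k, |c.K i k * g k| ≤ ∑ k, c.K i k * |g i| := by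
          refine Finset.sum_le_sum fun k _ => ?_
          rw [abs_mul, abs_of_nonneg (c.K_nonneg i k)]
          exact mul_le_mul_of_nonneg_left (hi k (Finset.mem_univ k)) (c.K_nonneg i k)
      _ = |g i| := by rw [← Finset.sum_mul, c.K_rowSum, one_mul]
  rw [abs_mul] at h2
  have h3 : |1 - x| ≤ 1 := by
    by_contra h4
    push Not at h4
    nlinarith
  rw [abs_le] at h3
  constructor <;> linarith

lemma exists_jacobiData (M : Fin (n + 1)) {κ : ℝ} (hκ : 0 < κ) (hlow : κ ≤ c.piLow M)
    (hhigh : κ ≤ c.piHigh M) :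
    ∃ lam bet : Fin n → ℝ, JacobiData c.symMat c.sqrtPi M κ lam bet :=
  c.isJacobi_symMat.exists_data c.sqrtPi_pos c.symMat_mulVec_sqrtPi
    (by simp only [sqrtPi_sq, c.pi_sum])
    (fun x v hv h => c.eig_mem_Icc ((c.symMat_eig_iff x).1 ⟨v, hv, h⟩)) M hκ
    (by simpa only [sqrtPi_sq, piLow] using hlow) (by simpa only [sqrtPi_sq, piHigh] using hhigh)

lemma symMat_diag (i : Fin (n + 1)) : c.symMat i i = 1 - c.K i i := by
  have := (c.sqrtPi_pos i).ne'
  simp only [symMat, Matrix.of_apply, Matrix.sub_apply, Matrix.one_apply_eq]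
  field_simp

lemma one_sub_K_diag_pos (hn : 0 < n) (i : Fin (n + 1)) : 0 < 1 - c.K i i := by
  have h := c.K_rowSum i
  obtain ⟨j, hj, hK⟩ : ∃ j, j ≠ i ∧ 0 < c.K i j := by
    rcases Nat.eq_zero_or_pos (i : ℕ) with h0 | h0
    · exact ⟨⟨1, by omega⟩, fun h => by rw [← h] at h0; simp at h0, c.K_pos_up (by simp [h0])⟩
    · exact ⟨⟨i - 1, by omega⟩, fun h => by have := congrArg Fin.val h; simp at this; omega,
        c.K_pos_down (by simp; omega)⟩
  rw [← Finset.add_sum_erase _ _ (Finset.mem_univ i)] at h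
  have : c.K i j ≤ ∑ k ∈ Finset.univ.erase i, c.K i k :=
    Finset.single_le_sum (fun k _ => c.K_nonneg i k) (by simp [hj])
  linarith

/-- Consecutive up and down probabilities add up to at most one. -/
def IsMono : Prop := ∀ i j : Fin (n + 1), (i : ℕ) + 1 = j → c.K i j + c.K j i ≤ 1

variable {c}

lemma IsMono.trace_le (hm : c.IsMono) : c.symMat.trace ≤ n := by
  have h1 : ∀ i, c.symMat i i = (∑ j, if i < j then c.K i j else 0) +
      ∑ j, if j < i then c.K i j else 0 := by
    intro i
    have e : c.K i i = ∑ j, if j = i then c.K i j else 0 := by simp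
    rw [symMat_diag, sub_eq_iff_eq_add, e, ← Finset.sum_add_distrib, ← Finset.sum_add_distrib,
      ← c.K_rowSum i]
    refine Finset.sum_congr rfl fun j _ => ?_
    rcases lt_trichotomy i j with h | h | h
    · simp [h, h.not_gt, h.ne']
    · simp [h]
    · simp [h, h.not_gt, h.ne]
  have hup : ∀ i : Fin n, (∑ j, if i.castSucc < j then c.K i.castSucc j else 0) =
      c.K i.castSucc i.succ := by
    intro i
    rw [Finset.sum_eq_single i.succ]
    · simp
    · intro j _ hj
      split_ifs with h
      · refine c.K_eq_zero_of_lt ?_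
        rw [Fin.lt_def] at h
        have : (j : ℕ) ≠ i + 1 := fun h' => hj (Fin.ext (by simpa using h'))
        simp at *
        omega
      · rfl
    · simp
  have hdn : ∀ i : Fin n, (∑ j, if j < i.succ then c.K i.succ j else 0) =
      c.K i.succ i.castSucc := by
    intro i
    rw [Finset.sum_eq_single i.castSucc]
    · simp
    · intro j _ hj
      split_ifs with h
      · refine c.K_eq_zero_of_gt ?_
        rw [Fin.lt_def] at h
        have : (j : ℕ) ≠ i := fun h' => hj (Fin.ext (by simpa using h'))
        simp at *
        omega
      · rfl
    · simp
  rw [Matrix.trace]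
  simp only [Matrix.diag_apply, h1, Finset.sum_add_distrib]
  rw [Fin.sum_univ_castSucc, Fin.sum_univ_succ (fun i => ∑ j, if j < i then c.K i j else 0)]
  simp only [hup, hdn]
  simp only [Fin.not_lt_zero, if_false, Finset.sum_const_zero, zero_add,
    (Fin.le_last _).not_gt, add_zero]
  rw [← Finset.sum_add_distrib]
  refine (Finset.sum_le_sum fun i _ => hm i.castSucc i.succ (by simp)).trans ?_
  simp

end BDChain

namespace BDChain

variable {n : ℕ} (c : BDChain n)

lemma pow_nonneg' (m : ℕ) (i j : Fin (n + 1)) : 0 ≤ (c.K ^ m) i j := by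
  induction m generalizing i j with
  | zero => rw [pow_zero, Matrix.one_apply]; split_ifs <;> norm_num
  | succ m ih =>
    rw [pow_succ, Matrix.mul_apply]
    exact Finset.sum_nonneg fun k _ => mul_nonneg (ih i k) (c.K_nonneg k j)

lemma pow_rowSum (m : ℕ) (i : Fin (n + 1)) : ∑ j, (c.K ^ m) i j = 1 := by
  induction m generalizing i with
  | zero => simp [Matrix.one_apply]
  | succ m ih =>
    simp_rw [pow_succ', Matrix.mul_apply]
    rw [Finset.sum_comm]
    simp_rw [← Finset.mul_sum, ih, mul_one]
    exact c.K_rowSum i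

lemma pow_le_one' (m : ℕ) (i j : Fin (n + 1)) : (c.K ^ m) i j ≤ 1 := by
  rw [← c.pow_rowSum m i]
  exact Finset.single_le_sum (fun k _ => c.pow_nonneg' m i k) (Finset.mem_univ j)

/-- The density of the chain started at `0` with respect to the stationary distribution. -/
def dens (m : ℕ) (y : Fin (n + 1)) : ℝ := (c.K ^ m) 0 y / c.pi y

lemma dens_succ (m : ℕ) (y : Fin (n + 1)) : c.dens (m + 1) y = ∑ z, c.K y z * c.dens m z := by
  simp only [dens]
  rw [pow_succ, Matrix.mul_apply, Finset.sum_div]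
  refine Finset.sum_congr rfl fun z _ => ?_
  have hy := (c.pi_pos y).ne'
  have hz := (c.pi_pos z).ne'
  have := c.reversible y z
  field_simp
  linear_combination -(c.K ^ m) 0 z * this

variable {c}

lemma IsMono.antitone_dens (hm : c.IsMono) (m : ℕ) : Antitone (c.dens m) := by
  induction m with
  | zero =>
    rw [Fin.antitone_iff_succ_le]
    intro i
    simp only [dens, pow_zero, Matrix.one_apply_ne (Fin.succ_ne_zero i).symm, zero_div]
    exact div_nonneg (c.pow_nonneg' 0 0 _) (c.pi_pos _).le
  | succ m ih =>
    rw [Fin.antitone_iff_succ_le]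
    intro i
    rw [dens_succ, dens_succ]
    set h := c.dens m
    have hd : h i.succ ≤ h i.castSucc := ih i.castSucc_lt_succ.le
    have hs : ∀ (y z₀ : Fin (n + 1)), ∑ z, c.K y z * (if z = z₀ then h z₀ else h y) =
        c.K y z₀ * (h z₀ - h y) + h y := by
      intro y z₀
      have : ∀ z, c.K y z * (if z = z₀ then h z₀ else h y) =
          (if z = z₀ then c.K y z * (h z₀ - h y) else 0) + c.K y z * h y := by
        intro z; split_ifs <;> ring
      simp_rw [this]
      rw [Finset.sum_add_distrib, ← Finset.sum_mul, c.K_rowSum]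
      simp
    have lo : c.K i.castSucc i.succ * (h i.succ - h i.castSucc) + h i.castSucc ≤
        ∑ z, c.K i.castSucc z * h z := by
      rw [← hs]
      refine Finset.sum_le_sum fun z _ => ?_
      by_cases hz : (z : ℕ) ≤ i + 1
      · refine mul_le_mul_of_nonneg_left ?_ (c.K_nonneg _ _)
        split_ifs with h1
        · rw [h1]
        · refine ih (Fin.le_def.2 ?_)
          have : (z : ℕ) ≠ i + 1 := fun h2 => h1 (Fin.ext (by simpa using h2))
          simp only [Fin.val_castSucc]
          omega
      · rw [c.K_eq_zero_of_lt (i := i.castSucc) (j := z) (by simp; omega)]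
        simp
    have hi : ∑ z, c.K i.succ z * h z ≤
        c.K i.succ i.castSucc * (h i.castSucc - h i.succ) + h i.succ := by
      rw [← hs]
      refine Finset.sum_le_sum fun z _ => ?_
      by_cases hz : (i : ℕ) ≤ z
      · refine mul_le_mul_of_nonneg_left ?_ (c.K_nonneg _ _)
        split_ifs with h1
        · rw [h1]
        · refine ih (Fin.le_def.2 ?_)
          have : (z : ℕ) ≠ i := fun h2 => h1 (Fin.ext (by simpa using h2))
          simp only [Fin.val_succ]
          omega
      · rw [c.K_eq_zero_of_gt (i := i.succ) (j := z) (by simp; omega)]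
        simp
    have := hm i.castSucc i.succ (by simp)
    nlinarith

lemma IsMono.sep_eq (hm : c.IsMono) (m : ℕ) : c.sep 0 m = 1 - c.dens m (Fin.last n) := by
  refine le_antisymm (ciSup_le fun y => ?_) ?_
  · exact sub_le_sub_left (hm.antitone_dens m (Fin.le_last y)) 1
  · exact le_ciSup (f := fun y => 1 - (c.K ^ m) 0 y / c.pi y) (Set.finite_range _).bddAbove
      (Fin.last n)

lemma IsMono.antitone_sep (hm : c.IsMono) : Antitone (c.sep 0) := by
  refine antitone_nat_of_succ_le fun m => ?_
  rw [hm.sep_eq, hm.sep_eq, dens_succ]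
  have : c.dens m (Fin.last n) ≤ ∑ z, c.K (Fin.last n) z * c.dens m z := by
    calc c.dens m (Fin.last n) = ∑ z, c.K (Fin.last n) z * c.dens m (Fin.last n) := by
          rw [← Finset.sum_mul, c.K_rowSum, one_mul]
      _ ≤ _ := Finset.sum_le_sum fun z _ =>
          mul_le_mul_of_nonneg_left (hm.antitone_dens m (Fin.le_last z)) (c.K_nonneg _ _)
  linarith

lemma IsMono.sep_nonneg (hm : c.IsMono) (m : ℕ) : 0 ≤ c.sep 0 m := by
  rw [hm.sep_eq]
  have : c.dens m (Fin.last n) ≤ 1 := by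
    calc c.dens m (Fin.last n) = ∑ y, c.pi y * c.dens m (Fin.last n) := by
          rw [← Finset.sum_mul, c.pi_sum, one_mul]
      _ ≤ ∑ y, c.pi y * c.dens m y := Finset.sum_le_sum fun z _ =>
          mul_le_mul_of_nonneg_left (hm.antitone_dens m (Fin.le_last z)) (c.pi_pos _).le
      _ = 1 := by
          rw [← c.pow_rowSum m 0]
          exact Finset.sum_congr rfl fun y _ => mul_div_cancel₀ _ (c.pi_pos y).ne'
  linarith

lemma IsMono.sep_le_one (hm : c.IsMono) (m : ℕ) : c.sep 0 m ≤ 1 := by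
  rw [hm.sep_eq]
  have : 0 ≤ c.dens m (Fin.last n) := div_nonneg (c.pow_nonneg' _ _ _) (c.pi_pos _).le
  linarith

lemma prod_div_add_eq {ι : Type*} [Fintype ι] (μ : ι → ℝ) {x : ℝ} (hx : x ∈ Set.Ioo (0 : ℝ) 1)
    (hμ : ∀ i, 0 < μ i) : ∏ i, (μ i * x / (1 - (1 - μ i) * x)) =
      (∏ i, μ i) / ∏ i, (1 / x - 1 + μ i) := by
  rw [← Finset.prod_div_distrib]
  refine Finset.prod_congr rfl fun i _ => ?_
  have h0 := hx.1
  have h1 := hx.2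
  have h2 := hμ i
  have : 1 / x - 1 + μ i = (1 - (1 - μ i) * x) / x := by field_simp; ring
  rw [this, div_div_eq_mul_div]

lemma IsMono.sep_generating (hm : c.IsMono) {M : Fin (n + 1)} {κ : ℝ} {lam bet : Fin n → ℝ}
    (hd : JacobiData c.symMat c.sqrtPi M κ lam bet) {x : ℝ} (hx : x ∈ Set.Ioo (0 : ℝ) 1) :
    1 - (1 - x) * ∑' m, c.sep 0 m * x ^ m = ∏ k, (lam k * x / (1 - (1 - lam k) * x)) := by
  have h0 := hx.1
  have hw : 0 < 1 / x - 1 := by rw [sub_pos]; exact (one_lt_div h0).2 hx.2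
  set g : Fin (n + 1) → ℝ := fun j => ∑' m, (c.K ^ m) j (Fin.last n) * x ^ m with hg
  have hrec : ∀ j, g j = (if j = Fin.last n then 1 else 0) + x * ∑ k, c.K j k * g k := by
    intro j
    have := tsum_orbit_eq c.K (fun m j => (c.K ^ m) j (Fin.last n))
      (fun m j => c.pow_nonneg' m j _) (fun m j => c.pow_le_one' m j _) (j := j)
      (fun m => by rw [pow_succ', Matrix.mul_apply]) hx
    simpa [Matrix.one_apply] using this
  have key := hd.lam_eq _ hw (c.sqrtPi (Fin.last n) / x) (fun j => c.sqrtPi j * g j) (by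
    intro j
    rw [smul_one_add_symMat_mulVec]
    have := hrec j
    split_ifs with h
    · rw [if_pos h] at this
      rw [h] at this ⊢
      have e : (1 / x - 1 + 1) * g (Fin.last n) - ∑ k, c.K (Fin.last n) k * g k = 1 / x := by
        field_simp; linarith
      rw [e]; ring
    · rw [if_neg h] at this
      have e : (1 / x - 1 + 1) * g j - ∑ k, c.K j k * g k = 0 := by
        field_simp; linarith
      rw [e, mul_zero])
  have hpos : 0 < ∏ k, (1 / x - 1 + lam k) :=
    Finset.prod_pos fun k _ => add_pos hw (hd.lam_pos k)
  have hsg : ∑' m, c.sep 0 m * x ^ m = 1 / (1 - x) - g 0 / c.pi (Fin.last n) := by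
    have hs1 := summable_geometric_of_lt_one h0.le hx.2
    have hs2 : Summable fun m => (c.K ^ m) 0 (Fin.last n) * x ^ m :=
      Summable.of_nonneg_of_le (fun m => mul_nonneg (c.pow_nonneg' _ _ _) (pow_nonneg h0.le m))
        (fun m => mul_le_of_le_one_left (pow_nonneg h0.le m) (c.pow_le_one' _ _ _)) hs1
    rw [one_div, ← tsum_geometric_of_lt_one h0.le hx.2]
    simp only [hg]
    rw [← tsum_div_const, ← hs1.tsum_sub (hs2.div_const _)]
    refine tsum_congr fun m => ?_
    rw [hm.sep_eq, dens]
    ring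
  rw [hsg, prod_div_add_eq lam hx hd.lam_pos]
  have hp := (c.pi_pos (Fin.last n))
  have hr := c.sqrtPi_pos 0
  have h1x : 1 - x ≠ 0 := by linarith [hx.2]
  have e1 : 1 - (1 - x) * (1 / (1 - x) - g 0 / c.pi (Fin.last n)) =
      (1 - x) * g 0 / c.pi (Fin.last n) := by field_simp; ring
  rw [e1, eq_div_iff hpos.ne', div_mul_eq_mul_div, div_eq_iff hp.ne', ← c.sqrtPi_sq]
  refine mul_left_cancel₀ hr.ne' ?_
  have hx' : x ≠ 0 := h0.ne'
  have e2 : 1 / x - 1 = (1 - x) / x := by field_simp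
  generalize ∏ k, (1 / x - 1 + lam k) = P at *
  rw [e2] at key
  field_simp at key
  linear_combination c.sqrtPi 0 * key

variable (c)

lemma hitSurv_self (i : Fin (n + 1)) (m : ℕ) : c.hitSurv i i m = 0 := by simp [hitSurv]

lemma hitSurv_zero {i j : Fin (n + 1)} (h : j ≠ i) : c.hitSurv i j 0 = 1 := by
  simp [hitSurv, h, Matrix.one_apply]

lemma hitSurv_succ {i j : Fin (n + 1)} (h : j ≠ i) (m : ℕ) :
    c.hitSurv i j (m + 1) = ∑ k, c.K j k * c.hitSurv i k m := by
  simp only [hitSurv, if_neg h, pow_succ', Matrix.mul_apply]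
  rw [Finset.sum_comm]
  refine Finset.sum_congr rfl fun k _ => ?_
  rw [← Finset.mul_sum]
  by_cases hk : k = i
  · simp [killed, hk]
  · simp [killed, h, hk]

lemma hitSurv_nonneg (i j : Fin (n + 1)) (m : ℕ) : 0 ≤ c.hitSurv i j m := by
  induction m generalizing j with
  | zero =>
    by_cases h : j = i
    · rw [h, hitSurv_self]
    · rw [c.hitSurv_zero h]; norm_num
  | succ m ih =>
    by_cases h : j = i
    · rw [h, hitSurv_self]
    · rw [c.hitSurv_succ h]
      exact Finset.sum_nonneg fun k _ => mul_nonneg (c.K_nonneg _ _) (ih k)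

lemma hitSurv_le_one (i j : Fin (n + 1)) (m : ℕ) : c.hitSurv i j m ≤ 1 := by
  induction m generalizing j with
  | zero =>
    by_cases h : j = i
    · rw [h, hitSurv_self]; norm_num
    · rw [c.hitSurv_zero h]
  | succ m ih =>
    by_cases h : j = i
    · rw [h, hitSurv_self]; norm_num
    · rw [c.hitSurv_succ h, ← c.K_rowSum j]
      exact Finset.sum_le_sum fun k _ => mul_le_of_le_one_right (c.K_nonneg _ _) (ih k)

variable {c}

lemma hit_generating {M : Fin (n + 1)} {κ : ℝ} {lam bet : Fin n → ℝ}
    (hd : JacobiData c.symMat c.sqrtPi M κ lam bet) {x : ℝ} (hx : x ∈ Set.Ioo (0 : ℝ) 1) :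
    (1 - (1 - x) * ∑' m, c.hitSurv M 0 m * x ^ m) *
      (1 - (1 - x) * ∑' m, c.hitSurv M (Fin.last n) m * x ^ m) =
      ∏ k, (bet k * x / (1 - (1 - bet k) * x)) := by
  have h0 := hx.1
  have hw : 0 < 1 / x - 1 := by rw [sub_pos]; exact (one_lt_div h0).2 hx.2
  set S : Fin (n + 1) → ℝ := fun j => ∑' m, c.hitSurv M j m * x ^ m with hS
  have hSM : S M = 0 := by simp [hS, hitSurv_self]
  have hrec : ∀ j ≠ M, S j = 1 + x * ∑ k, c.K j k * S k := by
    intro j hj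
    have := tsum_orbit_eq c.K (fun m j => c.hitSurv M j m)
      (fun m j => c.hitSurv_nonneg M j m) (fun m j => c.hitSurv_le_one M j m) (j := j)
      (fun m => c.hitSurv_succ hj m) hx
    rwa [c.hitSurv_zero hj] at this
  have key := hd.bet_eq _ hw (fun j => c.sqrtPi j * (1 - (1 - x) * S j)) (by
    intro j hj
    rw [smul_one_add_symMat_mulVec]
    have h1 := hrec j hj
    have h2 : ∑ k, c.K j k * (1 - (1 - x) * S k) = 1 - (1 - x) * ∑ k, c.K j k * S k := by
      simp_rw [mul_sub, mul_one]
      rw [Finset.sum_sub_distrib, c.K_rowSum, Finset.mul_sum]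
      congr 1
      exact Finset.sum_congr rfl fun k _ => by ring
    rw [h2]
    have e : (1 / x - 1 + 1) * (1 - (1 - x) * S j) - (1 - (1 - x) * ∑ k, c.K j k * S k) = 0 := by
      generalize ∑ k, c.K j k * S k = T at *
      rw [h1]
      field_simp
      ring
    rw [e, mul_zero])
  have hpos : 0 < ∏ k, (1 / x - 1 + bet k) :=
    Finset.prod_pos fun k _ => add_pos hw (hd.bet_pos k)
  rw [prod_div_add_eq bet hx hd.bet_pos, eq_div_iff hpos.ne']
  simp only [hSM, mul_zero, sub_zero, mul_one] at key
  have p0 := (c.sqrtPi_pos 0).ne'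
  have p1 := (c.sqrtPi_pos (Fin.last n)).ne'
  have p2 := (c.sqrtPi_pos M).ne'
  refine mul_left_cancel₀ (mul_ne_zero (mul_ne_zero p0 p1) (pow_ne_zero 2 p2)) ?_
  linear_combination key

end BDChain

/-- Quantitative description of the separation profile `a` of a birth and death chain through its
spectral data `lam`, `bet`, spectral gap `l`, and the mean `s` and variance `v` of hitting times. -/
structure SepData (n : ℕ) (a : ℕ → ℝ) (l s v κ : ℝ) (lam bet : Fin n → ℝ) : Prop where
  kap_pos : 0 < κ
  gap_pos : 0 < l
  gap_le : ∀ k, l ≤ lam k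
  gap_mem : ∃ k, l = lam k
  lam_le : ∀ k, lam k ≤ 2
  bet_le : ∀ k, bet k ≤ lam k
  sum_lam : ∑ k, lam k ≤ n
  sum_bet : ∑ k, bet k < n
  gap_le_bet : ∀ k, κ * l ≤ bet k
  sum_inv_le : ∑ k, 1 / bet k ≤ ∑ k, 1 / lam k + 1 / (κ * l)
  mean_eq : s = ∑ k, 1 / bet k
  var_eq : v = ∑ k, (1 - bet k) / bet k ^ 2
  nonneg : ∀ m, 0 ≤ a m
  le_one : ∀ m, a m ≤ 1
  anti : Antitone a
  summable : Summable a
  summable' : Summable fun m : ℕ => (m : ℝ) * a m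
  tsum_eq : ∑' m, a m = ∑ k, 1 / lam k
  tsum_eq' : ∑' m : ℕ, (2 * (m : ℝ) + 1) * a m - (∑ k, 1 / lam k) ^ 2 =
    ∑ k, (1 - lam k) / lam k ^ 2
  gen : ∀ x ∈ Set.Ioo (0 : ℝ) 1,
    1 - (1 - x) * ∑' m, a m * x ^ m = ∏ k, (lam k * x / (1 - (1 - lam k) * x))

lemma BDChain.IsMono.exists_sepData {n : ℕ} {c : BDChain n} (hm : c.IsMono) (hn : 0 < n)
    {l : ℝ} (hl : IsSmallestNonzeroEig (1 - c.K) l) (M : Fin (n + 1)) {κ : ℝ} (hκ : 0 < κ)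
    (hlow : κ ≤ c.piLow M) (hhigh : κ ≤ c.piHigh M) :
    ∃ lam bet : Fin n → ℝ, SepData n (c.sep 0) l (c.hitMean M 0 + c.hitMean M (Fin.last n))
      (c.hitVar M 0 + c.hitVar M (Fin.last n)) κ lam bet := by
  obtain ⟨lam, bet, hd⟩ := c.exists_jacobiData M hκ hlow hhigh
  obtain ⟨hl1, hl2, hl3⟩ := hl
  have hgap : ∀ k, l ≤ lam k := fun k =>
    hl3 _ ((c.symMat_eig_iff _).1 (hd.lam_mem k)) (hd.lam_pos k).ne'
  obtain ⟨k0, hk0⟩ := hd.mem_lam l hl2 ((c.symMat_eig_iff _).2 hl1)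
  have hlpos : 0 < l := hk0 ▸ hd.lam_pos k0
  obtain ⟨-, -, hmean, hvar⟩ := moments_of_generating_function bet hd.bet_pos (c.hitSurv M 0)
    (c.hitSurv M (Fin.last n)) (c.hitSurv_nonneg M 0) (c.hitSurv_le_one M 0)
    (c.hitSurv_nonneg M _) (c.hitSurv_le_one M _) (fun x hx => BDChain.hit_generating hd hx)
  obtain ⟨hs1, hs2, hmean', hvar'⟩ := moments_of_generating_function lam hd.lam_pos (c.sep 0)
    (fun _ => 0) hm.sep_nonneg hm.sep_le_one (fun _ => le_rfl) (fun _ => zero_le_one)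
    (fun x hx => by simpa using hm.sep_generating hd hx)
  simp only [tsum_zero, add_zero, mul_zero] at hmean' hvar'
  refine ⟨lam, bet, ⟨hκ, hlpos, hgap, ⟨k0, hk0⟩, hd.lam_le, hd.bet_le, ?_, ?_, hd.gap_le_bet l hgap,
    hd.sum_inv_le l hlpos hgap, hmean, hvar, hm.sep_nonneg, hm.sep_le_one, hm.antitone_sep, hs1, hs2,
    hmean', ?_, fun x hx => hm.sep_generating hd hx⟩⟩
  · rw [hd.sum_lam]; exact hm.trace_le
  · rw [hd.sum_bet, c.symMat_diag]
    have := hm.trace_le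
    have := c.one_sub_K_diag_pos hn M
    linarith
  · rw [← hvar', ← hmean']; ring

lemma mixD_spec {a : ℕ → ℝ} (h : Summable a) {ε : ℝ} (hε : 0 < ε) : a (mixD a ε) ≤ ε := by
  have : {m : ℕ | a m ≤ ε}.Nonempty :=
    ((h.tendsto_atTop_zero.eventually (gt_mem_nhds hε)).mono fun m hm => hm.le).exists
  exact Nat.sInf_mem this

lemma lt_of_lt_mixD {a : ℕ → ℝ} {ε : ℝ} {m : ℕ} (h : m < mixD a ε) : ε < a m := by
  by_contra h'
  exact Nat.notMem_of_lt_sInf h (not_lt.1 h')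

lemma mixD_le {a : ℕ → ℝ} {ε : ℝ} {m : ℕ} (h : a m ≤ ε) : mixD a ε ≤ m := Nat.sInf_le h

lemma sub_div_sq_antitone {x y : ℝ} (hx : 0 < x) (hxy : x ≤ y) (hy : y ≤ 2) :
    (1 - y) / y ^ 2 ≤ (1 - x) / x ^ 2 := by
  have hy0 : 0 < y := hx.trans_le hxy
  rw [div_le_div_iff₀ (by positivity) (by positivity)]
  nlinarith [mul_nonneg (sub_nonneg.2 hxy) (sub_nonneg.2 hy), mul_pos hx hy0,
    mul_nonneg (mul_nonneg (sub_nonneg.2 hxy) (sub_nonneg.2 hy)) hx.le,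
    mul_nonneg (sub_nonneg.2 hxy) (sub_nonneg.2 hxy)]

lemma one_sub_le_div_sq {x : ℝ} (hx : 0 < x) : 1 - x ≤ (1 - x) / x ^ 2 := by
  rw [le_div_iff₀ (by positivity)]
  nlinarith [mul_nonneg (sq_nonneg (1 - x)) (by linarith : 0 ≤ 1 + x)]

namespace SepData

variable {n : ℕ} {a : ℕ → ℝ} {l s v κ : ℝ} {lam bet : Fin n → ℝ}

lemma bet_pos (h : SepData n a l s v κ lam bet) (k : Fin n) : 0 < bet k :=
  (mul_pos h.kap_pos h.gap_pos).trans_le (h.gap_le_bet k)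

lemma lam_pos (h : SepData n a l s v κ lam bet) (k : Fin n) : 0 < lam k :=
  h.gap_pos.trans_le (h.gap_le k)

lemma gap_le_two (h : SepData n a l s v κ lam bet) : l ≤ 2 := by
  obtain ⟨k, hk⟩ := h.gap_mem
  exact hk ▸ h.lam_le k

lemma card_le (h : SepData n a l s v κ lam bet) : (n : ℝ) ≤ ∑ k, 1 / lam k := by
  have h1 : ∑ k, (2 - lam k) ≤ ∑ k, 1 / lam k := Finset.sum_le_sum fun k _ => by
    have := h.lam_pos k
    rw [le_div_iff₀ this]
    nlinarith [sq_nonneg (lam k - 1)]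
  rw [Finset.sum_sub_distrib] at h1
  simp at h1
  have := h.sum_lam
  simp
  linarith

lemma sum_inv_le_mean (h : SepData n a l s v κ lam bet) : ∑ k, 1 / lam k ≤ s := by
  rw [h.mean_eq]
  exact Finset.sum_le_sum fun k _ => one_div_le_one_div_of_le (h.bet_pos k) (h.bet_le k)

lemma mean_le (h : SepData n a l s v κ lam bet) : s ≤ ∑ k, 1 / lam k + 1 / (κ * l) :=
  h.mean_eq ▸ h.sum_inv_le

lemma var_lam_le (h : SepData n a l s v κ lam bet) : ∑ k, (1 - lam k) / lam k ^ 2 ≤ v := by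
  rw [h.var_eq]
  exact Finset.sum_le_sum fun k _ => sub_div_sq_antitone (h.bet_pos k) (h.bet_le k) (h.lam_le k)

lemma var_pos (h : SepData n a l s v κ lam bet) : 0 < v := by
  rw [h.var_eq]
  have h1 : ∑ k, (1 - bet k) ≤ ∑ k, (1 - bet k) / bet k ^ 2 :=
    Finset.sum_le_sum fun k _ => one_sub_le_div_sq (h.bet_pos k)
  rw [Finset.sum_sub_distrib] at h1
  simp only [Finset.sum_const, Finset.card_univ, Fintype.card_fin, nsmul_eq_mul, mul_one] at h1
  have := h.sum_bet
  linarith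

lemma var_le (h : SepData n a l s v κ lam bet) : v ≤ s / (κ * l) := by
  rw [h.var_eq, h.mean_eq, Finset.sum_div]
  refine Finset.sum_le_sum fun k _ => ?_
  have hb := h.bet_pos k
  have hk := mul_pos h.kap_pos h.gap_pos
  have := h.gap_le_bet k
  rw [div_div, div_le_div_iff₀ (by positivity) (by positivity)]
  nlinarith [mul_le_mul_of_nonneg_left this hb.le, mul_pos (mul_pos hb hb) hk]

lemma le_var (h : SepData n a l s v κ lam bet) (hl : l ≤ 1 / 2) : 1 / (4 * l ^ 2) ≤ v := by
  refine le_trans ?_ h.var_lam_le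
  obtain ⟨k, hk⟩ := h.gap_mem
  have h1 : ∑ j, ((1 - lam j) / lam j ^ 2 - (1 - lam j)) ≥ (1 - l) / l ^ 2 - (1 - l) := by
    rw [hk]
    exact Finset.single_le_sum (f := fun j => (1 - lam j) / lam j ^ 2 - (1 - lam j))
      (fun j _ => sub_nonneg.2 (one_sub_le_div_sq (h.lam_pos j))) (Finset.mem_univ k)
  rw [Finset.sum_sub_distrib, Finset.sum_sub_distrib] at h1
  simp only [Finset.sum_const, Finset.card_univ, Fintype.card_fin, nsmul_eq_mul, mul_one] at h1
  have := h.sum_lam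
  have h0 := h.gap_pos
  have h2 : 1 / (4 * l ^ 2) ≤ (1 - l) / l ^ 2 - (1 - l) := by
    rw [show (1 - l) / l ^ 2 - (1 - l) = ((1 - l) * (1 - l ^ 2)) / l ^ 2 by field_simp,
      div_le_div_iff₀ (by positivity) (by positivity)]
    have : 1 / 4 ≤ (1 - l) * (1 - l ^ 2) := by nlinarith
    nlinarith [sq_nonneg l]
  linarith

lemma abs_mixD_sub_le (h : SepData n a l s v κ lam bet) {ε : ℝ} (hε : ε ∈ Set.Ioo (0 : ℝ) 1) :
    |(mixD a ε : ℝ) - ∑ k, 1 / lam k| ≤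
      Real.sqrt v * (1 / Real.sqrt ε + 1 / Real.sqrt (1 - ε)) + 1 := by
  set θ := ∑ k, 1 / lam k with hθ
  have ch := chebyshev_of_survival h.nonneg (h.le_one 0) h.anti h.summable h.summable'
    h.tsum_eq h.tsum_eq'
  have hv := h.var_pos
  have hsv := Real.sqrt_pos.2 hv
  have hsε := Real.sqrt_pos.2 hε.1
  have hsε' := Real.sqrt_pos.2 (sub_pos.2 hε.2)
  have e1 : Real.sqrt v ^ 2 = v := Real.sq_sqrt hv.le
  have e2 : Real.sqrt ε ^ 2 = ε := Real.sq_sqrt hε.1.le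
  have e3 : Real.sqrt (1 - ε) ^ 2 = 1 - ε := Real.sq_sqrt (sub_pos.2 hε.2).le
  have hθ0 : 0 ≤ θ := (Nat.cast_nonneg n).trans h.card_le
  have p1 : 0 < Real.sqrt v / Real.sqrt ε := by positivity
  have p2 : 0 < Real.sqrt v / Real.sqrt (1 - ε) := by positivity
  rw [mul_add, mul_one_div, mul_one_div, abs_le]
  constructor
  · by_contra hlt
    push Not at hlt
    have hT : (mixD a ε : ℝ) ≤ θ := by linarith
    have h1 := (ch (mixD a ε)).2 hT
    have h2 := mixD_spec h.summable hε.1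
    have h3 : Real.sqrt v / Real.sqrt (1 - ε) < θ - mixD a ε := by linarith
    have h4 : (Real.sqrt v / Real.sqrt (1 - ε)) ^ 2 < (θ - mixD a ε) ^ 2 :=
      pow_lt_pow_left₀ h3 p2.le two_ne_zero
    rw [div_pow, e1, e3, div_lt_iff₀ (sub_pos.2 hε.2)] at h4
    have h5 := mul_le_mul_of_nonneg_left (sub_le_sub_left h2 1) (sq_nonneg (θ - mixD a ε))
    linarith [h.var_lam_le]
  · have hm : a ⌈θ + Real.sqrt v / Real.sqrt ε⌉₊ ≤ ε := by
      set m := ⌈θ + Real.sqrt v / Real.sqrt ε⌉₊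
      have h0 : θ + Real.sqrt v / Real.sqrt ε ≤ m := Nat.le_ceil _
      have h1 := (ch m).1 (by linarith)
      have h3 : Real.sqrt v / Real.sqrt ε < m + 1 - θ := by linarith
      have h4 : (Real.sqrt v / Real.sqrt ε) ^ 2 < (m + 1 - θ) ^ 2 :=
        pow_lt_pow_left₀ h3 p1.le two_ne_zero
      rw [div_pow, e1, e2, div_lt_iff₀ hε.1] at h4
      have h6 : (m + 1 - θ) ^ 2 * a m ≤ (m + 1 - θ) ^ 2 * ε := by
        linarith [h.var_lam_le]
      exact le_of_mul_le_mul_left h6 ((pow_pos p1 2).trans (pow_lt_pow_left₀ h3 p1.le two_ne_zero))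
    have h1 : (mixD a ε : ℝ) ≤ ⌈θ + Real.sqrt v / Real.sqrt ε⌉₊ := by exact_mod_cast mixD_le hm
    have h2 := Nat.ceil_lt_add_one (a := θ + Real.sqrt v / Real.sqrt ε) (by positivity)
    linarith

lemma gen_eq_inv (h : SepData n a l s v κ lam bet) {x : ℝ} (hx : x ∈ Set.Ioo (0 : ℝ) 1) :
    1 - (1 - x) * ∑' m, a m * x ^ m = (∏ k, (1 + (1 / x - 1) / lam k))⁻¹ := by
  rw [h.gen x hx, ← Finset.prod_inv_distrib]
  refine Finset.prod_congr rfl fun k _ => ?_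
  have h0 := hx.1
  have h1 := h.lam_pos k
  have : 1 + (1 / x - 1) / lam k = (1 - (1 - lam k) * x) / (lam k * x) := by
    field_simp; ring
  rw [this, inv_div]

lemma le_gen (h : SepData n a l s v κ lam bet) {x : ℝ} (hx : x ∈ Set.Ioo (0 : ℝ) 1) {δ : ℝ}
    (hδ : δ ∈ Set.Ioo (0 : ℝ) 1) :
    (1 - δ) * x ^ (mixD a δ) ≤ 1 - (1 - x) * ∑' m, a m * x ^ m := by
  set T := mixD a δ
  have hs := summable_mul_pow_of_mem_unit h.nonneg h.le_one hx
  have hg := hasSum_geometric_of_lt_one hx.1.le hx.2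
  have hx1 : 0 < 1 - x := sub_pos.2 hx.2
  have h1 : HasSum (fun m => if m < T then x ^ m else 0) (∑ m ∈ Finset.range T, x ^ m) := by
    have := hasSum_sum_of_ne_finset_zero (L := .unconditional ℕ) (f := fun m => if m < T then x ^ m else 0)
      (s := Finset.range T) (by intro b hb; simp at hb; simp [hb])
    convert this using 1
    exact Finset.sum_congr rfl fun m hm => by rw [if_pos (Finset.mem_range.1 hm)]
  have hle : ∑' m, a m * x ^ m ≤
      δ * (1 - x)⁻¹ + (1 - δ) * ∑ m ∈ Finset.range T, x ^ m := by
    refine hasSum_le (fun m => ?_) hs.hasSum ((hg.mul_left δ).add (h1.mul_left (1 - δ)))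
    have hp := pow_nonneg hx.1.le m
    split_ifs with hm
    · nlinarith [h.le_one m]
    · have := (h.anti (not_lt.1 hm)).trans (mixD_spec h.summable hδ.1)
      nlinarith
  rw [geom_sum_eq hx.2.ne] at hle
  have h3 := mul_le_mul_of_nonneg_left hle hx1.le
  have hx1' : x - 1 ≠ 0 := by linarith
  have e : (1 - x) * (δ * (1 - x)⁻¹ + (1 - δ) * ((x ^ T - 1) / (x - 1))) =
      δ + (1 - δ) * (1 - x ^ T) := by
    have : (x ^ T - 1) / (x - 1) = (1 - x ^ T) / (1 - x) := by
      rw [← neg_sub, ← neg_sub 1 x, neg_div_neg_eq]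
    rw [this]
    field_simp
  linarith

lemma gen_le (h : SepData n a l s v κ lam bet) {x : ℝ} (hx : x ∈ Set.Ioo (0 : ℝ) 1) {δ : ℝ}
    (hδ : δ ∈ Set.Ioo (0 : ℝ) 1) :
    1 - (1 - x) * ∑' m, a m * x ^ m ≤ δ + x ^ (mixD a (1 - δ)) := by
  set T := mixD a (1 - δ)
  have hs := summable_mul_pow_of_mem_unit h.nonneg h.le_one hx
  have hx1 : 0 < 1 - x := sub_pos.2 hx.2
  have hle : (1 - δ) * ∑ m ∈ Finset.range T, x ^ m ≤ ∑' m, a m * x ^ m := by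
    rw [Finset.mul_sum]
    refine (Finset.sum_le_sum fun m hm => ?_).trans
      (hs.sum_le_tsum _ fun m _ => mul_nonneg (h.nonneg m) (pow_nonneg hx.1.le m))
    exact mul_le_mul_of_nonneg_right (lt_of_lt_mixD (Finset.mem_range.1 hm)).le
      (pow_nonneg hx.1.le m)
  rw [geom_sum_eq hx.2.ne] at hle
  have h3 := mul_le_mul_of_nonneg_left hle hx1.le
  have hx1' : x - 1 ≠ 0 := by linarith
  have e : (1 - x) * ((1 - δ) * ((x ^ T - 1) / (x - 1))) = (1 - δ) * (1 - x ^ T) := by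
    have : (x ^ T - 1) / (x - 1) = (1 - x ^ T) / (1 - x) := by
      rw [← neg_sub, ← neg_sub 1 x, neg_div_neg_eq]
    rw [this]
    field_simp
  have := pow_nonneg hx.1.le T
  nlinarith [hδ.1]

end SepData

section SepFamily

open Topology

variable {a : ℕ → ℕ → ℝ} {l s v : ℕ → ℝ} {κ : ℝ}

/-- Every member of the family, except possibly the trivial one, has separation data. -/
def SepFamily (a : ℕ → ℕ → ℝ) (l s v : ℕ → ℝ) (κ : ℝ) : Prop :=
  ∀ n, 0 < n → ∃ lam bet : Fin n → ℝ, SepData n (a n) (l n) (s n) (v n) κ lam bet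

namespace SepFamily

lemma le_mean (h : SepFamily a l s v κ) {n : ℕ} (hn : 0 < n) : (n : ℝ) ≤ s n := by
  obtain ⟨lam, bet, hd⟩ := h n hn
  exact hd.card_le.trans hd.sum_inv_le_mean

lemma tendsto_ratio (h : SepFamily a l s v κ) (hκ : 0 < κ)
    (hsl : Tendsto (fun n => s n * l n) atTop atTop) :
    Tendsto (fun n => s n / Real.sqrt (v n)) atTop atTop := by
  have h1 : Tendsto (fun n => Real.sqrt (κ * (s n * l n))) atTop atTop :=
    Real.tendsto_sqrt_atTop.comp (hsl.const_mul_atTop hκ)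
  refine tendsto_atTop_mono' _ ?_ h1
  filter_upwards [eventually_gt_atTop 0] with n hn
  have hs : 0 ≤ s n := (Nat.cast_nonneg n).trans (h.le_mean hn)
  obtain ⟨lam, bet, hd⟩ := h n hn
  have hv := hd.var_pos
  have hl := hd.gap_pos
  rw [le_div_iff₀ (Real.sqrt_pos.2 hv), ← Real.sqrt_mul (by positivity)]
  refine Real.sqrt_le_iff.2 ⟨hs, ?_⟩
  have := mul_le_mul_of_nonneg_left hd.var_le (by positivity : 0 ≤ κ * (s n * l n))
  refine this.trans_eq ?_
  field_simp

lemma tendsto_gap (h : SepFamily a l s v κ)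
    (hr : Tendsto (fun n => s n / Real.sqrt (v n)) atTop atTop) :
    Tendsto (fun n => s n * l n) atTop atTop := by
  rw [tendsto_atTop]
  intro C
  filter_upwards [eventually_gt_atTop 0, hr.eventually_ge_atTop (2 * C),
    tendsto_natCast_atTop_atTop.eventually_ge_atTop (2 * C)] with n hn h1 h2
  have hs := h.le_mean hn
  have hs0 : 0 ≤ s n := (Nat.cast_nonneg n).trans hs
  obtain ⟨lam, bet, hd⟩ := h n hn
  have hl0 := hd.gap_pos
  have hsv := Real.sqrt_pos.2 hd.var_pos
  rcases le_or_gt (l n) (1 / 2) with hl | hl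
  · have h3 : 1 / (2 * l n) ≤ Real.sqrt (v n) := by
      refine Real.le_sqrt_of_sq_le ((le_of_eq ?_).trans (hd.le_var hl))
      field_simp; norm_num
    rw [div_le_iff₀ (by positivity)] at h3
    have h4 : s n / Real.sqrt (v n) ≤ s n * (2 * l n) := by
      rw [div_le_iff₀ hsv]
      nlinarith [mul_le_mul_of_nonneg_left h3 hs0]
    linarith
  · nlinarith

lemma abs_mixD_sub_le (h : SepFamily a l s v κ) (hκ : 0 < κ) {ε : ℝ} (hε : ε ∈ Set.Ioo (0 : ℝ) 1)
    {n : ℕ} (hn : 0 < n) : |(mixD (a n) ε : ℝ) - s n| ≤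
      (1 / Real.sqrt ε + 1 / Real.sqrt (1 - ε) + 2 + 1 / κ) *
        max (Real.sqrt (v n)) (1 / l n) := by
  obtain ⟨lam, bet, hd⟩ := h n hn
  have hl0 := hd.gap_pos
  have h1 := hd.abs_mixD_sub_le hε
  have h2 : |∑ k, 1 / lam k - s n| ≤ 1 / (κ * l n) := by
    rw [abs_le]
    have := hd.mean_le
    have := hd.sum_inv_le_mean
    have : 0 < 1 / (κ * l n) := by positivity
    constructor <;> linarith
  have h3 := abs_sub_le (mixD (a n) ε : ℝ) (∑ k, 1 / lam k) (s n)
  have b1 := le_max_left (Real.sqrt (v n)) (1 / l n)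
  have b2 := le_max_right (Real.sqrt (v n)) (1 / l n)
  set b := max (Real.sqrt (v n)) (1 / l n)
  have hC : 0 ≤ 1 / Real.sqrt ε + 1 / Real.sqrt (1 - ε) := by positivity
  have h4 := mul_le_mul_of_nonneg_right b1 hC
  have h5 : (1 : ℝ) ≤ 2 * (1 / l n) := by
    rw [mul_one_div, le_div_iff₀ hl0]
    linarith [hd.gap_le_two]
  have h6 : 1 / (κ * l n) ≤ 1 / κ * b := by
    rw [one_div_mul_eq_div, ← div_div, div_right_comm]
    exact div_le_div_of_nonneg_right b2 hκ.le
  linarith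

lemma cutoffWindow_of_ratio (h : SepFamily a l s v κ) (hκ : 0 < κ)
    (hr : Tendsto (fun n => s n / Real.sqrt (v n)) atTop atTop) :
    cutoffWindow (fun ε n => ((mixD (a n) ε : ℕ) : ℝ)) s
      (fun n => max (Real.sqrt (v n)) (1 / l n)) := by
  refine ⟨?_, ?_, ?_, fun ε hε =>
    ⟨1 / Real.sqrt ε + 1 / Real.sqrt (1 - ε) + 2 + 1 / κ, ?_⟩⟩
  · filter_upwards [eventually_gt_atTop 0] with n hn
    exact (Nat.cast_pos.2 hn).trans_le (h.le_mean hn)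
  · filter_upwards [eventually_gt_atTop 0] with n hn
    obtain ⟨lam, bet, hd⟩ := h n hn
    exact lt_max_of_lt_left (Real.sqrt_pos.2 hd.var_pos)
  · have h1 := hr.inv_tendsto_atTop
    have h2 := (h.tendsto_gap hr).inv_tendsto_atTop
    have h3 := h1.max h2
    rw [max_self] at h3
    refine h3.congr' ?_
    filter_upwards [eventually_gt_atTop 0] with n hn
    have hs : 0 < s n := (Nat.cast_pos.2 hn).trans_le (h.le_mean hn)
    simp only [Pi.inv_apply]
    rw [← max_div_div_right hs.le, inv_div, div_div, one_div, mul_comm (l n)]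
  · filter_upwards [eventually_gt_atTop 0] with n hn
    exact h.abs_mixD_sub_le hκ hε hn

lemma hasCutoff_of_window (h : SepFamily a l s v κ) {b : ℕ → ℝ}
    (hw : cutoffWindow (fun ε n => ((mixD (a n) ε : ℕ) : ℝ)) s b) :
    hasCutoff (fun ε n => ((mixD (a n) ε : ℕ) : ℝ)) := by
  have hs : ∀ n, 0 < n → 0 < s n := fun n hn => (Nat.cast_pos.2 hn).trans_le (h.le_mean hn)
  refine ⟨fun n => if 0 < n then s n else 1, fun n => ?_, fun ε hε => ?_⟩
  · dsimp only
    split_ifs with hn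
    · exact hs n hn
    · exact one_pos
  · obtain ⟨-, -, h3, h4⟩ := hw
    obtain ⟨C, hC⟩ := h4 ε hε
    rw [tendsto_iff_dist_tendsto_zero]
    refine squeeze_zero' (Eventually.of_forall fun n => dist_nonneg) ?_
      (by simpa using h3.const_mul C)
    filter_upwards [hC, eventually_gt_atTop 0] with n h5 hn
    have := hs n hn
    rw [if_pos hn, Real.dist_eq, div_sub_one this.ne', abs_div, abs_of_pos this, ← mul_div_assoc]
    exact div_le_div_of_nonneg_right h5 this.le

lemma tendsto_gen (h : SepFamily a l s v κ) {t : ℕ → ℝ} (ht : ∀ n, 0 < t n)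
    (hc : cutoffWith (fun ε n => ((mixD (a n) ε : ℕ) : ℝ)) t) {r : ℝ} (hr : 0 < r) :
    Tendsto (fun n => 1 - (1 - Real.exp (-(r / t n))) *
      ∑' m, a n m * Real.exp (-(r / t n)) ^ m) atTop (𝓝 (Real.exp (-r))) := by
  have hx : ∀ n, Real.exp (-(r / t n)) ∈ Set.Ioo (0 : ℝ) 1 := fun n =>
    ⟨Real.exp_pos _, Real.exp_lt_one_iff.2 (neg_lt_zero.2 (div_pos hr (ht n)))⟩
  have hpow : ∀ ε ∈ Set.Ioo (0 : ℝ) 1, Tendsto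
      (fun n => Real.exp (-(r / t n)) ^ (mixD (a n) ε)) atTop (𝓝 (Real.exp (-r))) := by
    intro ε hε
    have h1 := (((hc ε hε).const_mul r).neg).rexp
    rw [mul_one] at h1
    refine h1.congr fun n => ?_
    rw [← Real.exp_nat_mul]
    congr 1
    ring
  rw [tendsto_order]
  have he := Real.exp_pos (-r)
  constructor
  · intro y hy
    obtain ⟨δ, hδ, hδy⟩ : ∃ δ ∈ Set.Ioo (0 : ℝ) 1, y < (1 - δ) * Real.exp (-r) := by
      have : Tendsto (fun δ : ℝ => (1 - δ) * Real.exp (-r)) (𝓝[>] 0) (𝓝 (Real.exp (-r))) := by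
        have : Continuous fun δ : ℝ => (1 - δ) * Real.exp (-r) := by fun_prop
        have := this.tendsto 0
        simp only [sub_zero, one_mul] at this
        exact this.mono_left nhdsWithin_le_nhds
      have h2 := (this.eventually (lt_mem_nhds hy)).and (Ioo_mem_nhdsGT one_pos)
      obtain ⟨δ, h3, h4⟩ := h2.exists
      exact ⟨δ, h4, h3⟩
    filter_upwards [((hpow δ hδ).const_mul (1 - δ)).eventually (lt_mem_nhds hδy),
      eventually_gt_atTop 0] with n h1 hn
    obtain ⟨lam, bet, hd⟩ := h n hn
    exact h1.trans_le (hd.le_gen (hx n) hδ)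
  · intro y hy
    obtain ⟨δ, hδ, hδy⟩ : ∃ δ ∈ Set.Ioo (0 : ℝ) 1, δ + Real.exp (-r) < y := by
      refine ⟨min ((y - Real.exp (-r)) / 2) (1 / 2), ⟨?_, ?_⟩, ?_⟩
      · exact lt_min (by linarith) (by norm_num)
      · exact (min_le_right _ _).trans_lt (by norm_num)
      · have := min_le_left ((y - Real.exp (-r)) / 2) (1 / 2)
        linarith
    have hδ' : 1 - δ ∈ Set.Ioo (0 : ℝ) 1 := ⟨by linarith [hδ.2], by linarith [hδ.1]⟩
    filter_upwards [((hpow _ hδ').const_add δ).eventually (gt_mem_nhds hδy),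
      eventually_gt_atTop 0] with n h1 hn
    obtain ⟨lam, bet, hd⟩ := h n hn
    exact (hd.gen_le (hx n) hδ).trans_lt h1

end SepFamily

lemma one_add_sum_le_prod {ι : Type*} (S : Finset ι) {f : ι → ℝ} (hf : ∀ k, 0 ≤ f k) :
    1 + ∑ k ∈ S, f k ≤ ∏ k ∈ S, (1 + f k) := by
  classical
  induction S using Finset.induction_on with
  | empty => simp
  | insert k S hk ih =>
    rw [Finset.sum_insert hk, Finset.prod_insert hk]
    have h1 := mul_le_mul_of_nonneg_left ih (add_nonneg zero_le_one (hf k))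
    have h2 := mul_nonneg (hf k) (Finset.sum_nonneg fun j (_ : j ∈ S) => hf j)
    linarith

/-- Lower bound for `(∏ (1 + w / lam)) ^ 2 / ∏ (1 + (2 w + w ^ 2) / lam)`. -/
lemma prod_sq_div_prod_ge {n : ℕ} (lam : Fin n → ℝ) (hlam : ∀ k, 0 < lam k) (k₀ : Fin n)
    (hk : lam k₀ ≤ 1 / 2) {w : ℝ} (hw : 0 < w) (hw1 : w ≤ 1) :
    (1 + (w / lam k₀) ^ 2 / (2 * (1 + 3 * (w / lam k₀)))) * (1 - n * (w ^ 2 / 4)) ≤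
      (∏ k, (1 + w / lam k)) ^ 2 / ∏ k, (1 + (2 * w + w ^ 2) / lam k) := by
  rw [← Finset.prod_pow, ← Finset.prod_div_distrib]
  have hfac : ∀ k, (1 + w / lam k) ^ 2 / (1 + (2 * w + w ^ 2) / lam k) =
      1 + w ^ 2 * (1 - lam k) / (lam k * (lam k + 2 * w + w ^ 2)) := by
    intro k
    have := hlam k
    field_simp
    ring
  have hge : ∀ k, 1 - w ^ 2 / 4 ≤ (1 + w / lam k) ^ 2 / (1 + (2 * w + w ^ 2) / lam k) := by
    intro k
    have h1 := hlam k
    rw [hfac, sub_eq_add_neg, add_le_add_iff_left, ← neg_div, div_le_div_iff₀ (by norm_num)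
      (by positivity)]
    have : 0 ≤ (lam k - 2) ^ 2 + lam k * (2 * w + w ^ 2) := by positivity
    nlinarith [mul_nonneg (sq_nonneg w) this]
  have h01 : 0 ≤ 1 - w ^ 2 / 4 := by nlinarith
  have h0 : ∀ k, 0 ≤ (1 + w / lam k) ^ 2 / (1 + (2 * w + w ^ 2) / lam k) := fun k =>
    h01.trans (hge k)
  rw [← Finset.mul_prod_erase _ _ (Finset.mem_univ k₀)]
  have hprod : 1 - n * (w ^ 2 / 4) ≤ ∏ k ∈ Finset.univ.erase k₀,
      (1 + w / lam k) ^ 2 / (1 + (2 * w + w ^ 2) / lam k) := by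
    have b1 : 1 + (n : ℝ) * (-(w ^ 2 / 4)) ≤ (1 + -(w ^ 2 / 4)) ^ n :=
      one_add_mul_le_pow (by nlinarith) n
    have b2 : (1 - w ^ 2 / 4) ^ n ≤ (1 - w ^ 2 / 4) ^ (n - 1) :=
      pow_le_pow_of_le_one h01 (by nlinarith [sq_nonneg w]) (Nat.sub_le n 1)
    have b3 : (1 - w ^ 2 / 4) ^ (n - 1) ≤ ∏ k ∈ Finset.univ.erase k₀,
        (1 + w / lam k) ^ 2 / (1 + (2 * w + w ^ 2) / lam k) := by
      have : (1 - w ^ 2 / 4) ^ (n - 1) = ∏ k ∈ Finset.univ.erase k₀, (1 - w ^ 2 / 4) := by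
        rw [Finset.prod_const, Finset.card_erase_of_mem (Finset.mem_univ _)]
        simp
      rw [this]
      exact Finset.prod_le_prod (fun _ _ => h01) fun k _ => hge k
    rw [← sub_eq_add_neg] at b1
    linarith
  have h00 := hlam k₀
  have hfirst : 1 + (w / lam k₀) ^ 2 / (2 * (1 + 3 * (w / lam k₀))) ≤
      (1 + w / lam k₀) ^ 2 / (1 + (2 * w + w ^ 2) / lam k₀) := by
    rw [hfac, add_le_add_iff_left]
    have : (w / lam k₀) ^ 2 / (2 * (1 + 3 * (w / lam k₀))) =
        w ^ 2 / (2 * (lam k₀ * (lam k₀ + 3 * w))) := by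
      field_simp
    rw [this, div_le_div_iff₀ (by positivity) (by positivity)]
    have e1 : lam k₀ * (lam k₀ + 2 * w + w ^ 2) ≤ lam k₀ * (lam k₀ + 3 * w) :=
      mul_le_mul_of_nonneg_left (by nlinarith) h00.le
    have e2 : lam k₀ * (lam k₀ + 3 * w) ≤ (1 - lam k₀) * (2 * (lam k₀ * (lam k₀ + 3 * w))) := by
      have : 0 < lam k₀ * (lam k₀ + 3 * w) := by positivity
      nlinarith
    nlinarith [mul_le_mul_of_nonneg_left (e1.trans e2) (sq_nonneg w)]
  have hpos : 0 ≤ 1 + (w / lam k₀) ^ 2 / (2 * (1 + 3 * (w / lam k₀))) := by positivity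
  exact (mul_le_mul_of_nonneg_left hprod hpos).trans
    (mul_le_mul_of_nonneg_right hfirst (Finset.prod_nonneg fun k _ => h0 k))

namespace SepFamily

set_option maxHeartbeats 1000000 in
lemma tendsto_gap_of_cutoff (h : SepFamily a l s v κ)
    (hc : hasCutoff (fun ε n => ((mixD (a n) ε : ℕ) : ℝ))) :
    Tendsto (fun n => s n * l n) atTop atTop := by
  obtain ⟨t, ht, hct⟩ := hc
  have g1 := h.tendsto_gen ht hct one_pos
  have g2 := h.tendsto_gen ht hct two_pos
  have gr : Tendsto (fun n => (1 - (1 - Real.exp (-(2 / t n))) *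
      ∑' m, a n m * Real.exp (-(2 / t n)) ^ m) / (1 - (1 - Real.exp (-(1 / t n))) *
      ∑' m, a n m * Real.exp (-(1 / t n)) ^ m) ^ 2) atTop (𝓝 1) := by
    have := g2.div (g1.pow 2) (pow_ne_zero 2 (Real.exp_pos _).ne')
    rwa [← Real.exp_nat_mul, show ((2 : ℕ) : ℝ) * -1 = -2 by norm_num,
      div_self (Real.exp_pos _).ne'] at this
  rw [tendsto_atTop]
  intro C₀
  obtain ⟨C, hC, hCC⟩ : ∃ C : ℝ, 0 < C ∧ C₀ ≤ C := ⟨max C₀ 1, by positivity, le_max_left _ _⟩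
  set δ := 1 / (2 * C) with hδ
  have hδ0 : 0 < δ := by positivity
  set η := δ ^ 2 / (2 * (1 + 3 * δ)) with hη
  have hη0 : 0 < η := by positivity
  have l1 : Real.exp (-1) < 2 / 3 := by
    have := Real.exp_one_gt_d9
    rw [Real.exp_neg, inv_lt_comm₀ (Real.exp_pos _) (by norm_num)]
    norm_num
    linarith
  have l2 : 1 / 3 < Real.exp (-1) := by
    have := Real.exp_one_lt_d9
    rw [Real.exp_neg, lt_inv_comm₀ (by norm_num) (Real.exp_pos _)]
    norm_num
    linarith
  have l1' : Real.exp (-1) < Real.exp (-(1 / 2)) := Real.exp_lt_exp.2 (by norm_num)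
  have hlim : Tendsto (fun n : ℕ => (1 + η) * (1 - 1 / (n : ℝ))) atTop (𝓝 ((1 + η) * (1 - 0))) :=
    (tendsto_const_nhds.sub tendsto_one_div_atTop_nhds_zero_nat).const_mul _
  have hmid : 1 + η / 2 < (1 + η) * (1 - 0) := by linarith
  have hmid' : (1 : ℝ) < 1 + η / 2 := by linarith
  filter_upwards [eventually_ge_atTop 2, g1.eventually (gt_mem_nhds l1'),
    g1.eventually (lt_mem_nhds l2), gr.eventually (gt_mem_nhds hmid'),
    hlim.eventually (lt_mem_nhds hmid),
    tendsto_natCast_atTop_atTop.eventually_ge_atTop (2 * C)] with n hn e1 e2 e3 e4 e5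
  have hn0 : 0 < n := by omega
  have hs := h.le_mean hn0
  obtain ⟨lam, bet, hd⟩ := h n hn0
  have hn2 : (2 : ℝ) ≤ n := by exact_mod_cast hn
  have hx : ∀ r : ℝ, 0 < r → Real.exp (-(r / t n)) ∈ Set.Ioo (0 : ℝ) 1 := fun r hr =>
    ⟨Real.exp_pos _, Real.exp_lt_one_iff.2 (neg_lt_zero.2 (div_pos hr (ht n)))⟩
  refine hCC.trans ?_
  have hl0 := hd.gap_pos
  rcases lt_or_ge (1 / 2) (l n) with hl | hl
  · nlinarith
  rw [hd.gen_eq_inv (hx _ one_pos), hd.gen_eq_inv (hx _ two_pos)] at e3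
  rw [hd.gen_eq_inv (hx _ one_pos)] at e1 e2
  set w := 1 / Real.exp (-(1 / t n)) - 1 with hw
  have hw0 : 0 < w := by
    have := hx 1 one_pos
    rw [hw, sub_pos]; exact (one_lt_div this.1).2 this.2
  have hw2 : 1 / Real.exp (-(2 / t n)) - 1 = 2 * w + w ^ 2 := by
    have : Real.exp (-(2 / t n)) = Real.exp (-(1 / t n)) ^ 2 := by
      rw [← Real.exp_nat_mul]; congr 1; push_cast; ring
    rw [this, hw]
    have := (Real.exp_pos (-(1 / t n))).ne'
    field_simp
    ring
  rw [hw2] at e3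
  set G := ∏ k, (1 + w / lam k) with hG
  have hG0 : 0 < G := Finset.prod_pos fun k _ => by have := hd.lam_pos k; positivity
  have hG3 : G < 3 := by
    rw [lt_inv_comm₀ (by norm_num) hG0] at e2
    norm_num at e2
    exact e2
  set θ := ∑ k, 1 / lam k with hθ
  have hwθ : ∑ k, w / lam k = w * θ := by
    rw [hθ, Finset.mul_sum]; exact Finset.sum_congr rfl fun k _ => by ring
  have hlow : 1 + w * θ ≤ G := by
    rw [← hwθ]
    exact one_add_sum_le_prod _ fun k => by have := hd.lam_pos k; positivity
  have hup : 1 / 2 < w * θ := by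
    have h1 : G ≤ Real.exp (w * θ) := by
      rw [← hwθ, Real.exp_sum]
      refine Finset.prod_le_prod (fun k _ => by have := hd.lam_pos k; positivity) fun k _ => ?_
      rw [add_comm]; exact Real.add_one_le_exp _
    have h2 : Real.exp (1 / 2) < G := by
      rw [Real.exp_neg] at e1
      exact (inv_lt_inv₀ hG0 (Real.exp_pos _)).1 e1
    exact Real.exp_lt_exp.1 (h2.trans_le h1)
  have hwn : w * n ≤ 2 := by nlinarith [hd.card_le]
  have hw1 : w ≤ 1 := by nlinarith
  by_contra hlt
  push Not at hlt
  obtain ⟨k₀, hk₀⟩ := hd.gap_mem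
  have hz : δ < w / l n := by
    have h1 := hd.sum_inv_le_mean
    have h2 : θ * l n < C := lt_of_le_of_lt (mul_le_mul_of_nonneg_right h1 hl0.le) hlt
    have h3 : w * (θ * l n) < w * C := mul_lt_mul_of_pos_left h2 hw0
    have h4 : 1 / 2 * l n < w * θ * l n := mul_lt_mul_of_pos_right hup hl0
    rw [hδ, div_lt_div_iff₀ (by positivity) hl0]
    linarith
  have key := prod_sq_div_prod_ge lam hd.lam_pos k₀ (hk₀ ▸ hl) hw0 hw1
  rw [← hk₀] at key
  set z := w / l n with hzdef
  have hηz : η ≤ z ^ 2 / (2 * (1 + 3 * z)) := by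
    have hz0 : 0 < z := hδ0.trans hz
    rw [hη, div_le_div_iff₀ (by positivity) (by positivity)]
    have h1 : 0 < z - δ := sub_pos.2 hz
    linarith [mul_pos (mul_pos hz0 hδ0) h1, mul_pos h1 (add_pos hz0 hδ0)]
  have hn1 : 1 / (n : ℝ) ≤ 1 := by rw [div_le_one (by linarith)]; linarith
  have hnw : 1 - 1 / (n : ℝ) ≤ 1 - n * (w ^ 2 / 4) := by
    have : n * (w ^ 2 / 4) ≤ 1 / (n : ℝ) := by
      rw [le_div_iff₀ (by linarith)]
      have : (w * n) ^ 2 ≤ 2 ^ 2 := pow_le_pow_left₀ (by positivity) hwn 2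
      nlinarith
    linarith
  have h5 : (1 + η) * (1 - 1 / (n : ℝ)) ≤
      (1 + z ^ 2 / (2 * (1 + 3 * z))) * (1 - n * (w ^ 2 / 4)) :=
    mul_le_mul (by linarith) hnw (by linarith) (by linarith)
  have h6 : (∏ k, (1 + (2 * w + w ^ 2) / lam k))⁻¹ / G⁻¹ ^ 2 =
      G ^ 2 / ∏ k, (1 + (2 * w + w ^ 2) / lam k) := by
    rw [inv_pow, div_inv_eq_mul, mul_comm, div_eq_mul_inv]
  rw [h6] at e3
  linarith

end SepFamily

end SepFamily

/-- Theorem `t-sep2`(2).  Discrete-time version: under the monotonicity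
condition `K_n(i,i+1) + K_n(i+1,i) ≤ 1`, the left-boundary family `F^L` has a separation
cutoff iff `s_n λ_n → ∞` iff `s_n / c_n → ∞`, and if `s_n / c_n → ∞` then `F^L` has a
`(s_n, max{c_n, 1/λ_n})` separation cutoff, where `s_n = E_0 τ_{M_n} + E_n τ_{M_n}` and
`c_n² = Var_0 τ_{M_n} + Var_n τ_{M_n}` (discrete-time hitting times). -/
theorem birth_death_discrete_separation_cutoff
    (F : (n : ℕ) → BDChain n) (lam : ℕ → ℝ)
    (hlam : ∀ n, 0 < n → IsSmallestNonzeroEig (1 - (F n).K) (lam n))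
    (hmono : ∀ n, ∀ i : ℕ, ∀ h : i < n,
      (F n).K ⟨i, by omega⟩ ⟨i + 1, by omega⟩ + (F n).K ⟨i + 1, by omega⟩ ⟨i, by omega⟩ ≤ 1)
    (M : (n : ℕ) → Fin (n + 1))
    (hMlow : ∃ c > 0, ∀ n, c ≤ (F n).piLow (M n))
    (hMhigh : ∃ c > 0, ∀ n, c ≤ (F n).piHigh (M n))
    (s c : ℕ → ℝ)
    (hs : ∀ n, s n = (F n).hitMean (M n) 0 + (F n).hitMean (M n) (Fin.last n))
    (hc : ∀ n, c n =
      Real.sqrt ((F n).hitVar (M n) 0 + (F n).hitVar (M n) (Fin.last n))) :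
    (hasCutoff (fun ε n => ((mixD ((F n).sep 0) ε : ℕ) : ℝ)) ↔
      Filter.Tendsto (fun n => s n * lam n) Filter.atTop Filter.atTop) ∧
    (hasCutoff (fun ε n => ((mixD ((F n).sep 0) ε : ℕ) : ℝ)) ↔
      Filter.Tendsto (fun n => s n / c n) Filter.atTop Filter.atTop) ∧
    (Filter.Tendsto (fun n => s n / c n) Filter.atTop Filter.atTop →
      cutoffWindow (fun ε n => ((mixD ((F n).sep 0) ε : ℕ) : ℝ)) s
        (fun n => max (c n) (1 / lam n))) := by
  obtain ⟨c₁, hc₁, h₁⟩ := hMlow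
  obtain ⟨c₂, hc₂, h₂⟩ := hMhigh
  have hκ : 0 < min c₁ c₂ := lt_min hc₁ hc₂
  have hF : SepFamily (fun n => (F n).sep 0) lam s
      (fun n => (F n).hitVar (M n) 0 + (F n).hitVar (M n) (Fin.last n)) (min c₁ c₂) := by
    intro n hn
    rw [hs n]
    refine BDChain.IsMono.exists_sepData ?_ hn (hlam n hn) (M n) hκ
      ((min_le_left _ _).trans (h₁ n)) ((min_le_right _ _).trans (h₂ n))
    rintro ⟨i, hi⟩ ⟨j, hj⟩ hij
    obtain rfl : i + 1 = j := hij
    exact hmono n i (by omega)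
  obtain rfl : c = fun n =>
      Real.sqrt ((F n).hitVar (M n) 0 + (F n).hitVar (M n) (Fin.last n)) := funext hc
  refine ⟨⟨hF.tendsto_gap_of_cutoff, fun h => ?_⟩, ⟨fun h => ?_, fun h => ?_⟩,
    fun h => hF.cutoffWindow_of_ratio hκ h⟩
  · exact hF.hasCutoff_of_window (hF.cutoffWindow_of_ratio hκ (hF.tendsto_ratio hκ h))
  · exact hF.tendsto_ratio hκ (hF.tendsto_gap_of_cutoff h)
  · exact hF.hasCutoff_of_window (hF.cutoffWindow_of_ratio hκ h)

end
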